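/- Converse garbage-dimension bound: Consider any (n,R,P,ε) local purity distillation protocol for a bipartite state ρ^{AB} on systems of dimensions d_A, d_B, and set δ = 2/(en) + ε log(d_A d_B). Let Y denote the register that Alice inputs to the dephasing channel, and evaluate entropies on the state U_A((ρ^{AB})^{⊗n} ⊗ |0⟩⟨0|^C) before dephasing. Then log(d_{A_g} d_{B_g}) ≥ n H(A)_ρ + n H(B)_ρ − I(Y;B^n) − nδ. -/

import Mathlib

noncomputable section
namespace LPD

open Matrix Kronecker BigOperators Filter Finset
open scoped ComplexOrder

/-- The positive semidefinite square root of a positive semidefinite matrix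
(the definition of the older Mathlib). -/
def _root_.Matrix.PosSemidef.sqrt {n 𝕜 : Type*} [Fintype n] [RCLike 𝕜] [DecidableEq n]
    {A : Matrix n n 𝕜} (hA : A.PosSemidef) : Matrix n n 𝕜 :=
  hA.1.eigenvectorUnitary.1 * Matrix.diagonal ((↑) ∘ Real.sqrt ∘ hA.1.eigenvalues) *
    (star hA.1.eigenvectorUnitary : Matrix n n 𝕜)

/-- The trace norm `‖ω‖₁ = Tr √(ωᴴ ω)` of a matrix. -/
def traceNorm {ι : Type*} [Fintype ι] [DecidableEq ι] (ω : Matrix ι ι ℂ) : ℝ :=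
  ((Matrix.posSemidef_conjTranspose_mul_self ω).sqrt).trace.re

/-- A density operator: positive semidefinite with trace one. -/
def IsDensity {ι : Type*} [Fintype ι] (ρ : Matrix ι ι ℂ) : Prop :=
  ρ.PosSemidef ∧ ρ.trace = 1

/-- The von Neumann entropy `H(ρ) = -Tr(ρ log ρ)`, expressed via eigenvalues
(with the convention `0 log 0 = 0`, and junk value `0` on non-Hermitian input). -/
def entropy {ι : Type*} [Fintype ι] [DecidableEq ι] (ρ : Matrix ι ι ℂ) : ℝ :=
  letI := Classical.dec ρ.IsHermitian
  if h : ρ.IsHermitian then -∑ i, h.eigenvalues i * Real.log (h.eigenvalues i) else 0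

/-- Partial trace over the first (left) tensor factor. -/
def ptraceLeft {α β : Type*} [Fintype α] (ρ : Matrix (α × β) (α × β) ℂ) : Matrix β β ℂ :=
  fun b b' => ∑ a, ρ (a, b) (a, b')

/-- Partial trace over the second (right) tensor factor. -/
def ptraceRight {α β : Type*} [Fintype β] (ρ : Matrix (α × β) (α × β) ℂ) : Matrix α α ℂ :=
  fun a a' => ∑ b, ρ (a, b) (a', b)

/-- Quantum mutual information `I(A;B) = H(A) + H(B) - H(AB)` of a bipartite state. -/
def mutualInfo {α β : Type*} [Fintype α] [DecidableEq α] [Fintype β] [DecidableEq β]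
    (ρ : Matrix (α × β) (α × β) ℂ) : ℝ :=
  entropy (ptraceRight ρ) + entropy (ptraceLeft ρ) - entropy ρ

/-- Conditional entropy `H(B|A) = H(AB) - H(A)` (second system conditioned on the first). -/
def condEntropySnd {α β : Type*} [Fintype α] [DecidableEq α] [Fintype β] [DecidableEq β]
    (ρ : Matrix (α × β) (α × β) ℂ) : ℝ :=
  entropy ρ - entropy (ptraceRight ρ)

/-- Conditional entropy `H(A|B) = H(AB) - H(B)` (first system conditioned on the second). -/
def condEntropyFst {α β : Type*} [Fintype α] [DecidableEq α] [Fintype β] [DecidableEq β]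
    (ρ : Matrix (α × β) (α × β) ℂ) : ℝ :=
  entropy ρ - entropy (ptraceLeft ρ)

/-- `n`-fold tensor power of a matrix. -/
def tpow {ι : Type*} (ρ : Matrix ι ι ℂ) (n : ℕ) : Matrix (Fin n → ι) (Fin n → ι) ℂ :=
  fun x y => ∏ k, ρ (x k) (y k)

/-- `n`-fold tensor power of a bipartite state, with the `A` and `B` factors collected. -/
def tpowAB {α β : Type*} (ρ : Matrix (α × β) (α × β) ℂ) (n : ℕ) :
    Matrix ((Fin n → α) × (Fin n → β)) ((Fin n → α) × (Fin n → β)) ℂ :=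
  Matrix.reindex (Equiv.arrowProdEquivProdArrow (Fin n) (fun _ => α) (fun _ => β))
    (Equiv.arrowProdEquivProdArrow (Fin n) (fun _ => α) (fun _ => β)) (tpow ρ n)

/-- A POVM on the system `ι` with outcome set `κ`. -/
structure POVM (ι κ : Type*) [Fintype ι] [DecidableEq ι] [Fintype κ] where
  elem : κ → Matrix ι ι ℂ
  pos : ∀ y, (elem y).PosSemidef
  sum_eq : ∑ y, elem y = 1

/-- Apply a POVM to the first factor of a bipartite state, recording the outcome in a
classical register: `ρ^{AΓ} ↦ Σ_y |y⟩⟨y| ⊗ Tr_A((Λ_y ⊗ 1)ρ)`. -/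
def measureLeft {ι κ γ : Type*} [Fintype ι] [DecidableEq ι] [Fintype κ] [DecidableEq κ]
    (Λ : POVM ι κ) (ρ : Matrix (ι × γ) (ι × γ) ℂ) : Matrix (κ × γ) (κ × γ) ℂ :=
  fun p q => if p.1 = q.1 then ∑ a, ∑ a', (Λ.elem p.1) a a' * ρ (a', p.2) (a, q.2) else 0

/-- The canonical purification of a density operator `ρ` on `ι`, a pure state on `ι × ι`
(junk value `0` for non-positive-semidefinite input). -/
def canonicalPurification {ι : Type*} [Fintype ι] [DecidableEq ι] (ρ : Matrix ι ι ℂ) :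
    Matrix (ι × ι) (ι × ι) ℂ :=
  letI := Classical.dec ρ.PosSemidef
  if h : ρ.PosSemidef then
    vecMulVec (fun p => h.sqrt p.1 p.2) (star fun p => h.sqrt p.1 p.2)
  else 0

/-- The purity `κ(ρ) = log d - H(ρ)`. -/
def kappa {ι : Type*} [Fintype ι] [DecidableEq ι] (ρ : Matrix ι ι ℂ) : ℝ :=
  Real.log (Fintype.card ι) - entropy ρ

/-- The pure state `|0⟩⟨0|` on a `d`-dimensional system. -/
def pureZero (d : ℕ) : Matrix (Fin d) (Fin d) ℂ :=
  fun i j => if i.val = 0 ∧ j.val = 0 then 1 else 0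

/-! ### Index bookkeeping equivalences -/

/-- `(a × b) × c ≃ (a × c) × b`. -/
def swapE (a b c : Type*) : (a × b) × c ≃ (a × c) × b where
  toFun x := ((x.1.1, x.2), x.1.2)
  invFun x := ((x.1.1, x.2), x.1.2)
  left_inv _ := rfl
  right_inv _ := rfl

/-- Pull the `Y` register to the front: `((a × y) × g) × b ≃ y × ((a × g) × b)`. -/
def pullY (a y g b : Type*) : ((a × y) × g) × b ≃ y × ((a × g) × b) where
  toFun x := (x.1.1.2, ((x.1.1.1, x.1.2), x.2))
  invFun x := (((x.2.1.1, x.1), x.2.1.2), x.2.2)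
  left_inv _ := rfl
  right_inv _ := rfl

/-- Rearrange for Bob's unitary: `((a × y) × g) × b ≃ (b × y) × (a × g)`. -/
def pullBY (a y g b : Type*) : ((a × y) × g) × b ≃ (b × y) × (a × g) where
  toFun x := ((x.2, x.1.1.2), (x.1.1.1, x.1.2))
  invFun x := (((x.2.1, x.1.2), x.2.2), x.1.1)
  left_inv _ := rfl
  right_inv _ := rfl

/-- Collect `Y` and `B` together: `((a × y) × g) × b ≃ (y × b) × (a × g)`. -/
def pullYB (a y g b : Type*) : ((a × y) × g) × b ≃ (y × b) × (a × g) where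
  toFun x := ((x.1.1.2, x.2), (x.1.1.1, x.1.2))
  invFun x := (((x.2.1, x.1.1), x.2.2), x.1.2)
  left_inv _ := rfl
  right_inv _ := rfl

/-- Sort output registers: `(bp × bg) × (ap × ag) ≃ (ap × bp) × (ag × bg)`. -/
def sortOut (bp bg ap ag : Type*) : (bp × bg) × (ap × ag) ≃ (ap × bp) × (ag × bg) where
  toFun x := ((x.2.1, x.1.1), (x.2.2, x.1.2))
  invFun x := ((x.1.2, x.2.2), (x.1.1, x.2.1))
  left_inv _ := rfl
  right_inv _ := rfl

/-- `y × (x × w) ≃ (y × w) × x`. -/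
def exYW (y x w : Type*) : y × (x × w) ≃ (y × w) × x where
  toFun a := ((a.1, a.2.2), a.2.1)
  invFun a := (a.1.1, (a.2, a.1.2))
  left_inv _ := rfl
  right_inv _ := rfl

/-- `y × (x × w) ≃ (y × x) × w`. -/
def exYX (y x w : Type*) : y × (x × w) ≃ (y × x) × w where
  toFun a := ((a.1, a.2.1), a.2.2)
  invFun a := (a.1.1, (a.1.2, a.2))
  left_inv _ := rfl
  right_inv _ := rfl

/-- `y × (x × (b × e)) ≃ (y × b) × (x × e)`. -/
def exYB (y x b e : Type*) : y × (x × (b × e)) ≃ (y × b) × (x × e) where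
  toFun a := ((a.1, a.2.2.1), (a.2.1, a.2.2.2))
  invFun a := (a.1.1, (a.2.1, (a.1.2, a.2.2)))
  left_inv _ := rfl
  right_inv _ := rfl

/-! ### The state `σ^{YBE}` obtained by measuring Alice's share of a purification -/

/-- The canonical purification of a bipartite state `ρ^{AB}`, with indices arranged as
`A × (B × E)` where `E = A × B`. -/
def purifyAssoc {α β : Type*} [Fintype α] [DecidableEq α] [Fintype β] [DecidableEq β]
    (ρ : Matrix (α × β) (α × β) ℂ) :
    Matrix (α × (β × (α × β))) (α × (β × (α × β))) ℂ :=
  Matrix.reindex (Equiv.prodAssoc α β (α × β)) (Equiv.prodAssoc α β (α × β))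
    (canonicalPurification ρ)

/-- `σ^{YBE} = (Λ ⊗ 1^{BE})(Ψ^{ABE})` for the canonical purification `Ψ` of `ρ^{AB}`. -/
def sigmaOf {α β κ : Type*} [Fintype α] [DecidableEq α] [Fintype β] [DecidableEq β]
    [Fintype κ] [DecidableEq κ] (ρ : Matrix (α × β) (α × β) ℂ) (Λ : POVM α κ) :
    Matrix (κ × (β × (α × β))) (κ × (β × (α × β))) ℂ :=
  measureLeft Λ (purifyAssoc ρ)

/-- `I(Y;B)` evaluated on a state of the form `σ^{Y(BE)}`: trace out `E`, then take the
mutual information. -/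
def IYB {κ β ε : Type*} [Fintype κ] [DecidableEq κ] [Fintype β] [DecidableEq β] [Fintype ε]
    (σ : Matrix (κ × (β × ε)) (κ × (β × ε)) ℂ) : ℝ :=
  mutualInfo (ptraceRight (Matrix.reindex (Equiv.prodAssoc κ β ε).symm
    (Equiv.prodAssoc κ β ε).symm σ))

/-- `I(Y;BE)` evaluated on a state of the form `σ^{Y(BE)}`. -/
def IYBE {κ β ε : Type*} [Fintype κ] [DecidableEq κ] [Fintype β] [DecidableEq β] [Fintype ε]
    [DecidableEq ε] (σ : Matrix (κ × (β × ε)) (κ × (β × ε)) ℂ) : ℝ :=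
  mutualInfo σ

/-- `P^{(1)}_→(ρ^{AB}, R) = max_Λ { I(Y;B)_σ : I(Y;BE)_σ ≤ R }`, the maximum over all
POVMs on Alice's system. -/
def P1 {α β : Type*} [Fintype α] [DecidableEq α] [Fintype β] [DecidableEq β]
    (ρ : Matrix (α × β) (α × β) ℂ) (R : ℝ) : ℝ :=
  sSup { v : ℝ | ∃ (m : ℕ) (Λ : POVM α (Fin m)),
    IYBE (sigmaOf ρ Λ) ≤ R ∧ v = IYB (sigmaOf ρ Λ) }

/-! ### Local purity distillation protocols -/

/-- An `(n, ·, ·, ·)` local purity distillation protocol: Alice's unitary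
`U_A : H_{A^n} ⊗ H_C → H_{A_p} ⊗ H_Y ⊗ H_{A_g}`, a dephasing channel on `Y`
(applied below), and Bob's unitary `U_B : H_{B^n} ⊗ H_Y → H_{B_p} ⊗ H_{B_g}`. -/
structure Protocol (α β : Type*) [Fintype α] [DecidableEq α] [Fintype β] [DecidableEq β]
    (n : ℕ) where
  dC : ℕ
  dAp : ℕ
  dY : ℕ
  dAg : ℕ
  dBp : ℕ
  dBg : ℕ
  dC_pos : 0 < dC
  dAp_pos : 0 < dAp
  dY_pos : 0 < dY
  dAg_pos : 0 < dAg
  dBp_pos : 0 < dBp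
  dBg_pos : 0 < dBg
  UA : Matrix ((Fin dAp × Fin dY) × Fin dAg) ((Fin n → α) × Fin dC) ℂ
  UA_unitary : UAᴴ * UA = 1 ∧ UA * UAᴴ = 1
  UB : Matrix (Fin dBp × Fin dBg) ((Fin n → β) × Fin dY) ℂ
  UB_unitary : UBᴴ * UB = 1 ∧ UB * UBᴴ = 1

variable {α β : Type*} [Fintype α] [DecidableEq α] [Fintype β] [DecidableEq β]

/-- The input state `(ρ^{AB})^{⊗n} ⊗ |0⟩⟨0|^C`, arranged as `(A^n × C) × B^n`. -/
def inputState (ρ : Matrix (α × β) (α × β) ℂ) {n : ℕ} (Pr : Protocol α β n) :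
    Matrix (((Fin n → α) × Fin Pr.dC) × (Fin n → β))
      (((Fin n → α) × Fin Pr.dC) × (Fin n → β)) ℂ :=
  Matrix.reindex (swapE (Fin n → α) (Fin n → β) (Fin Pr.dC))
    (swapE (Fin n → α) (Fin n → β) (Fin Pr.dC)) (tpowAB ρ n ⊗ₖ pureZero Pr.dC)

/-- The state `U_A((ρ^{AB})^{⊗n} ⊗ |0⟩⟨0|^C)` (before dephasing), on
`((A_p × Y) × A_g) × B^n`. -/
def stateAfterUA (ρ : Matrix (α × β) (α × β) ℂ) {n : ℕ} (Pr : Protocol α β n) :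
    Matrix (((Fin Pr.dAp × Fin Pr.dY) × Fin Pr.dAg) × (Fin n → β))
      (((Fin Pr.dAp × Fin Pr.dY) × Fin Pr.dAg) × (Fin n → β)) ℂ :=
  (Pr.UA ⊗ₖ (1 : Matrix (Fin n → β) (Fin n → β) ℂ)) * inputState ρ Pr *
    (Pr.UA ⊗ₖ (1 : Matrix (Fin n → β) (Fin n → β) ℂ))ᴴ

/-- Dephase the first tensor factor in a fixed basis. -/
def dephaseFst {κ γ : Type*} [DecidableEq κ] (ρ : Matrix (κ × γ) (κ × γ) ℂ) :
    Matrix (κ × γ) (κ × γ) ℂ :=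
  fun p q => if p.1 = q.1 then ρ p q else 0

/-- The state after Alice's unitary and the dephasing channel on `Y`. -/
def stateAfterDephasing (ρ : Matrix (α × β) (α × β) ℂ) {n : ℕ} (Pr : Protocol α β n) :
    Matrix (((Fin Pr.dAp × Fin Pr.dY) × Fin Pr.dAg) × (Fin n → β))
      (((Fin Pr.dAp × Fin Pr.dY) × Fin Pr.dAg) × (Fin n → β)) ℂ :=
  Matrix.reindex (pullY (Fin Pr.dAp) (Fin Pr.dY) (Fin Pr.dAg) (Fin n → β)).symm
    (pullY (Fin Pr.dAp) (Fin Pr.dY) (Fin Pr.dAg) (Fin n → β)).symm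
    (dephaseFst (Matrix.reindex (pullY (Fin Pr.dAp) (Fin Pr.dY) (Fin Pr.dAg) (Fin n → β))
      (pullY (Fin Pr.dAp) (Fin Pr.dY) (Fin Pr.dAg) (Fin n → β)) (stateAfterUA ρ Pr)))

/-- The final state `Υ`, after Bob's unitary, on `(B_p × B_g) × (A_p × A_g)`. -/
def stateAfterUB (ρ : Matrix (α × β) (α × β) ℂ) {n : ℕ} (Pr : Protocol α β n) :
    Matrix ((Fin Pr.dBp × Fin Pr.dBg) × (Fin Pr.dAp × Fin Pr.dAg))
      ((Fin Pr.dBp × Fin Pr.dBg) × (Fin Pr.dAp × Fin Pr.dAg)) ℂ :=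
  (Pr.UB ⊗ₖ (1 : Matrix (Fin Pr.dAp × Fin Pr.dAg) (Fin Pr.dAp × Fin Pr.dAg) ℂ)) *
    Matrix.reindex (pullBY (Fin Pr.dAp) (Fin Pr.dY) (Fin Pr.dAg) (Fin n → β))
      (pullBY (Fin Pr.dAp) (Fin Pr.dY) (Fin Pr.dAg) (Fin n → β)) (stateAfterDephasing ρ Pr) *
    (Pr.UB ⊗ₖ (1 : Matrix (Fin Pr.dAp × Fin Pr.dAg) (Fin Pr.dAp × Fin Pr.dAg) ℂ))ᴴ

/-- The reduced output state `Υ^{A_p B_p}`. -/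
def outputReduced (ρ : Matrix (α × β) (α × β) ℂ) {n : ℕ} (Pr : Protocol α β n) :
    Matrix (Fin Pr.dAp × Fin Pr.dBp) (Fin Pr.dAp × Fin Pr.dBp) ℂ :=
  ptraceRight (Matrix.reindex
    (sortOut (Fin Pr.dBp) (Fin Pr.dBg) (Fin Pr.dAp) (Fin Pr.dAg))
    (sortOut (Fin Pr.dBp) (Fin Pr.dBg) (Fin Pr.dAp) (Fin Pr.dAg)) (stateAfterUB ρ Pr))

/-- The error of a protocol: trace distance of `Υ^{A_p B_p}` from `|0⟩⟨0| ⊗ |0⟩⟨0|`. -/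
def protocolError (ρ : Matrix (α × β) (α × β) ℂ) {n : ℕ} (Pr : Protocol α β n) : ℝ :=
  traceNorm (outputReduced ρ Pr - pureZero Pr.dAp ⊗ₖ pureZero Pr.dBp)

/-- The classical communication rate `(1/n) log d_Y` of a protocol. -/
def commRate {n : ℕ} (Pr : Protocol α β n) : ℝ := Real.log Pr.dY / n

/-- The purity rate `(1/n)(log d_{A_p}d_{B_p} - log d_C)` of a protocol. -/
def purityRate {n : ℕ} (Pr : Protocol α β n) : ℝ :=
  (Real.log (Pr.dAp * Pr.dBp) - Real.log Pr.dC) / n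

/-- Achievability of a rate pair `(P, R)`: for all `ε, δ > 0` and all sufficiently large `n`
there is an `(n, R+δ, P-δ, ε)` protocol. -/
def Achievable (ρ : Matrix (α × β) (α × β) ℂ) (P R : ℝ) : Prop :=
  ∀ ε > (0 : ℝ), ∀ δ > (0 : ℝ), ∃ N : ℕ, ∀ n ≥ N, ∃ Pr : Protocol α β n,
    commRate Pr ≤ R + δ ∧ P - δ ≤ purityRate Pr ∧ protocolError ρ Pr ≤ ε

/-- The 1-way distillable local purity `κ_→(ρ^{AB}, R)`. -/
def kappaArrow (ρ : Matrix (α × β) (α × β) ℂ) (R : ℝ) : ℝ :=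
  sSup { P : ℝ | Achievable ρ P R }

/-- `I(Y;B^n)` on the pre-dephasing state `U_A((ρ^{AB})^{⊗n} ⊗ |0⟩⟨0|^C)`. -/
def preDephIYB (ρ : Matrix (α × β) (α × β) ℂ) {n : ℕ} (Pr : Protocol α β n) : ℝ :=
  mutualInfo (ptraceRight (Matrix.reindex
    (pullYB (Fin Pr.dAp) (Fin Pr.dY) (Fin Pr.dAg) (Fin n → β))
    (pullYB (Fin Pr.dAp) (Fin Pr.dY) (Fin Pr.dAg) (Fin n → β)) (stateAfterUA ρ Pr)))

/-- The pre-dephasing state together with the purifying environment `E^n`: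
`(U_A ⊗ 1^{B^nE^n})((Ψ^{ABE})^{⊗n} ⊗ |0⟩⟨0|^C)`, where `Ψ` is the canonical purification. -/
def preDephWithEnv (ρ : Matrix (α × β) (α × β) ℂ) {n : ℕ} (Pr : Protocol α β n) :
    Matrix (((Fin Pr.dAp × Fin Pr.dY) × Fin Pr.dAg) × (Fin n → β × (α × β)))
      (((Fin Pr.dAp × Fin Pr.dY) × Fin Pr.dAg) × (Fin n → β × (α × β))) ℂ :=
  (Pr.UA ⊗ₖ (1 : Matrix (Fin n → β × (α × β)) (Fin n → β × (α × β)) ℂ)) *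
    Matrix.reindex (swapE (Fin n → α) (Fin n → β × (α × β)) (Fin Pr.dC))
      (swapE (Fin n → α) (Fin n → β × (α × β)) (Fin Pr.dC))
      (tpowAB (purifyAssoc ρ) n ⊗ₖ pureZero Pr.dC) *
    (Pr.UA ⊗ₖ (1 : Matrix (Fin n → β × (α × β)) (Fin n → β × (α × β)) ℂ))ᴴ

/-- `I(Y;B^nE^n)` on the pre-dephasing state, including the purifying environment. -/
def preDephIYBE (ρ : Matrix (α × β) (α × β) ℂ) {n : ℕ} (Pr : Protocol α β n) : ℝ :=
  mutualInfo (ptraceRight (Matrix.reindex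
    (pullYB (Fin Pr.dAp) (Fin Pr.dY) (Fin Pr.dAg) (Fin n → β × (α × β)))
    (pullYB (Fin Pr.dAp) (Fin Pr.dY) (Fin Pr.dAg) (Fin n → β × (α × β)))
    (preDephWithEnv ρ Pr)))

/-- `H(Y)` on the pre-dephasing state. -/
def preDephHY (ρ : Matrix (α × β) (α × β) ℂ) {n : ℕ} (Pr : Protocol α β n) : ℝ :=
  entropy (ptraceRight (Matrix.reindex
    (pullY (Fin Pr.dAp) (Fin Pr.dY) (Fin Pr.dAg) (Fin n → β))
    (pullY (Fin Pr.dAp) (Fin Pr.dY) (Fin Pr.dAg) (Fin n → β)) (stateAfterUA ρ Pr)))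

/-! ### Single-party purity concentration -/

/-- An `(n, ·, ·)` purity concentration protocol: a unitary
`U : H_{A^n} → H_{A_p} ⊗ H_{A_g}`. -/
structure ConcProtocol (α : Type*) [Fintype α] [DecidableEq α] (n : ℕ) where
  dAp : ℕ
  dAg : ℕ
  dAp_pos : 0 < dAp
  dAg_pos : 0 < dAg
  U : Matrix (Fin dAp × Fin dAg) (Fin n → α) ℂ
  U_unitary : Uᴴ * U = 1 ∧ U * Uᴴ = 1

/-- The reduced state `Υ^{A_p}` of `U ρ^{⊗n} U†`. -/
def concOutput {α : Type*} [Fintype α] [DecidableEq α] (ρ : Matrix α α ℂ) {n : ℕ}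
    (Pr : ConcProtocol α n) : Matrix (Fin Pr.dAp) (Fin Pr.dAp) ℂ :=
  ptraceRight (Pr.U * tpow ρ n * Pr.Uᴴ)

/-- Achievability of a purity-concentration rate `P`. -/
def ConcAchievable {α : Type*} [Fintype α] [DecidableEq α] (ρ : Matrix α α ℂ) (P : ℝ) :
    Prop :=
  ∀ ε > (0 : ℝ), ∀ δ > (0 : ℝ), ∃ N : ℕ, ∀ n ≥ N, ∃ Pr : ConcProtocol α n,
    P - δ ≤ Real.log Pr.dAp / n ∧ traceNorm (concOutput ρ Pr - pureZero Pr.dAp) ≤ ε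

/-- The purity `κ(ρ)`: the supremum of all achievable concentration rates. -/
def kappaConc {α : Type*} [Fintype α] [DecidableEq α] (ρ : Matrix α α ℂ) : ℝ :=
  sSup { P : ℝ | ConcAchievable ρ P }

/-! ### Measurement compression -/

/-- The averaged compressed-measurement map
`σ ↦ (1/|L|) Σ_l Σ_m Tr(Λ̃^{(l)}_m σ) |f(m,l)⟩⟨f(m,l)|`, applied to the first factor. -/
def mcMap {A Ω γ' : Type*} [Fintype A] [DecidableEq A] [Fintype Ω] [DecidableEq Ω]
    (L M : ℕ) (Λt : Fin L → POVM A (Fin M)) (f : Fin M → Fin L → Ω)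
    (ρ : Matrix (A × γ') (A × γ') ℂ) : Matrix (Ω × γ') (Ω × γ') ℂ :=
  fun p q => (L : ℂ)⁻¹ * ∑ l, ∑ m, (if f m l = p.1 ∧ f m l = q.1 then 1 else 0) *
    ∑ a, ∑ a', ((Λt l).elem m) a a' * ρ (a', p.2) (a, q.2)

/-! ### Classical-quantum states and classical channels -/

/-- The classical-quantum state `Σ_x p(x) |x⟩⟨x| ⊗ ρ_x`. -/
def cqState {𝒳 B : Type*} [DecidableEq 𝒳] (p : 𝒳 → ℝ) (ρx : 𝒳 → Matrix B B ℂ) :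
    Matrix (𝒳 × B) (𝒳 × B) ℂ :=
  fun P Q => if P.1 = Q.1 then (p P.1 : ℂ) * ρx P.1 P.2 Q.2 else 0

/-- The state on `Y × (X × W)` obtained from a purification vector `ψ` of a cq state
(with classical system `X` and the rest `W`) by applying a classical channel `q(y|x)`
to the classical system: `Σ_{x,y} q(y|x) |y⟩⟨y| ⊗ |x⟩⟨x|-block of p(x)·(BE state given x)`. -/
def chanState {𝒳 W 𝒴 : Type*} [DecidableEq 𝒳] [DecidableEq 𝒴]
    (ψ : 𝒳 × W → ℂ) (q : 𝒳 → 𝒴 → ℝ) :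
    Matrix (𝒴 × (𝒳 × W)) (𝒴 × (𝒳 × W)) ℂ :=
  fun P Q => if P.1 = Q.1 ∧ P.2.1 = Q.2.1
    then (q P.2.1 P.1 : ℂ) * ψ P.2 * star (ψ Q.2) else 0

/-- The `n`-fold tensor power of a purification vector of a cq state, with the
classical, `B` and `E` registers collected. -/
def vecPowBE {𝒳 B E : Type*} (ψ : 𝒳 × (B × E) → ℂ) (n : ℕ) :
    (Fin n → 𝒳) × ((Fin n → B) × (Fin n → E)) → ℂ :=
  fun xw => ∏ k, ψ (xw.1 k, (xw.2.1 k, xw.2.2 k))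

variable {𝒴' 𝒳 B E : Type*} [Fintype 𝒴'] [DecidableEq 𝒴'] [Fintype 𝒳] [DecidableEq 𝒳]
  [Fintype B] [DecidableEq B] [Fintype E] [DecidableEq E]

/-- `I(Y;B)` on a state of the form `τ^{Y(X(BE))}`. -/
def miYB (τ : Matrix (𝒴' × (𝒳 × (B × E))) (𝒴' × (𝒳 × (B × E))) ℂ) : ℝ :=
  mutualInfo (ptraceRight (Matrix.reindex (exYB 𝒴' 𝒳 B E) (exYB 𝒴' 𝒳 B E) τ))

/-- `I(Y;BE)` on a state of the form `τ^{Y(X(BE))}`. -/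
def miYBE (τ : Matrix (𝒴' × (𝒳 × (B × E))) (𝒴' × (𝒳 × (B × E))) ℂ) : ℝ :=
  mutualInfo (ptraceRight (Matrix.reindex (exYW 𝒴' 𝒳 (B × E)) (exYW 𝒴' 𝒳 (B × E)) τ))

/-- `I(Y;X)` on a state of the form `τ^{Y(X(BE))}`. -/
def miYX (τ : Matrix (𝒴' × (𝒳 × (B × E))) (𝒴' × (𝒳 × (B × E))) ℂ) : ℝ :=
  mutualInfo (ptraceRight (Matrix.reindex (exYX 𝒴' 𝒳 (B × E)) (exYX 𝒴' 𝒳 (B × E)) τ))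

/-- A classical channel: entrywise nonnegative with rows summing to one. -/
def IsChannel {X Y : Type*} [Fintype Y] (q : X → Y → ℝ) : Prop :=
  (∀ x y, 0 ≤ q x y) ∧ ∀ x, ∑ y, q x y = 1

/-- `P_n(R) = max_{Y|X^n} { (1/n) I(Y;B^n) : (1/n) I(Y;B^nE^n) ≤ R }` for a cq state
with purification vector `ψ`. -/
def Pn (ψ : 𝒳 × (B × E) → ℂ) (n : ℕ) (R : ℝ) : ℝ :=
  sSup { v : ℝ | ∃ (m : ℕ) (q : (Fin n → 𝒳) → Fin m → ℝ), IsChannel q ∧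
    (1 / n : ℝ) * miYBE (chanState (vecPowBE ψ n) q) ≤ R ∧
    v = (1 / n : ℝ) * miYB (chanState (vecPowBE ψ n) q) }

/-- `D_n(R) = max_{Y|X^n} { (1/n) I(Y;B^n) : (1/n)(I(Y;X^n) - I(Y;B^n)) ≤ R }` for a cq
state with purification vector `ψ`. -/
def Dn (ψ : 𝒳 × (B × E) → ℂ) (n : ℕ) (R : ℝ) : ℝ :=
  sSup { v : ℝ | ∃ (m : ℕ) (q : (Fin n → 𝒳) → Fin m → ℝ), IsChannel q ∧
    (1 / n : ℝ) * (miYX (chanState (vecPowBE ψ n) q)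
      - miYB (chanState (vecPowBE ψ n) q)) ≤ R ∧
    v = (1 / n : ℝ) * miYB (chanState (vecPowBE ψ n) q) }

/-! ### Quantum channels -/

/-- A completely positive trace-preserving map between matrix algebras. -/
structure CPTP (ι κ : Type*) [Fintype ι] [DecidableEq ι] [Fintype κ] [DecidableEq κ] where
  map : Matrix ι ι ℂ →ₗ[ℂ] Matrix κ κ ℂ
  trace_preserving : ∀ ρ, (map ρ).trace = ρ.trace
  completely_positive : ∀ (n : ℕ) (ρ : Matrix (ι × Fin n) (ι × Fin n) ℂ), ρ.PosSemidef →
    (Matrix.of fun p q : κ × Fin n =>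
      map (Matrix.of fun i i' => ρ (i, p.2) (i', q.2)) p.1 q.1).PosSemidef



lemma log_sum_le_of_resolvent {I J : Type*} [Fintype I] [Fintype J]
    (w x : I → ℝ) (u z : J → ℝ) (hw : ∀ i, 0 ≤ w i) (hu : ∀ k, 0 ≤ u k)
    (hx : ∀ i, 0 ≤ x i) (hz : ∀ k, 0 ≤ z k)
    (hwx : ∀ i, w i ≠ 0 → 0 < x i) (huz : ∀ k, u k ≠ 0 → 0 < z k)
    (hsum : ∑ i, w i = ∑ k, u k)
    (h : ∀ t : ℝ, 0 < t → ∑ k, u k / (z k + t) ≤ ∑ i, w i / (x i + t)) :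
    ∑ i, w i * Real.log (x i) ≤ ∑ k, u k * Real.log (z k) := by
  set Φ : ℝ → ℝ := fun t => ∑ i, w i * Real.log (x i + t) - ∑ k, u k * Real.log (z k + t) with hΦ
  have hcont1 : ∀ (w x : ℝ), 0 ≤ x → (w ≠ 0 → 0 < x) →
      ContinuousOn (fun t => w * Real.log (x + t)) (Set.Ici 0) := by
    intro w x hx hwx
    by_cases hw0 : w = 0
    · simp [hw0]; exact continuousOn_const
    · have := hwx hw0
      refine ContinuousOn.mul continuousOn_const (ContinuousOn.log (by fun_prop) ?_)
      intro t ht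
      have : 0 ≤ t := ht
      positivity
  have hcont : ContinuousOn Φ (Set.Ici 0) := by
    refine ContinuousOn.sub ?_ ?_
    · exact continuousOn_finsetSum _ fun i _ => hcont1 _ _ (hx i) (hwx i)
    · exact continuousOn_finsetSum _ fun i _ => hcont1 _ _ (hz i) (huz i)
  have hder : ∀ t : ℝ, 0 < t → HasDerivAt Φ (∑ i, w i / (x i + t) - ∑ k, u k / (z k + t)) t := by
    intro t ht
    have key : ∀ (w x : ℝ), 0 ≤ x → HasDerivAt (fun t => w * Real.log (x + t)) (w / (x + t)) t := by
      intro w x hx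
      have h1 : HasDerivAt (fun t => x + t) 1 t := (hasDerivAt_id t).const_add x
      have h2 := (h1.log (by positivity)).const_mul w
      exact h2.congr_deriv (mul_one_div _ _)
    refine HasDerivAt.sub ?_ ?_
    · exact HasDerivAt.fun_sum fun i _ => key _ _ (hx i)
    · exact HasDerivAt.fun_sum fun i _ => key _ _ (hz i)
  have hmono : MonotoneOn Φ (Set.Ici 0) := by
    refine monotoneOn_of_deriv_nonneg (convex_Ici 0) hcont ?_ ?_
    · intro t ht
      rw [interior_Ici] at ht
      exact (hder t ht).differentiableAt.differentiableWithinAt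
    · intro t ht
      rw [interior_Ici] at ht
      rw [(hder t ht).deriv]
      linarith [h t ht]
  have hlim1 : ∀ (w x : ℝ), Tendsto (fun t => w * (Real.log (x + t) - Real.log t)) atTop (nhds 0) := by
    intro w x
    have h1 : Tendsto (fun t : ℝ => x / t + 1) atTop (nhds (0 + 1)) :=
      (tendsto_const_nhds.div_atTop tendsto_id).add tendsto_const_nhds
    have h2 := ((Real.continuousAt_log (x := 0 + 1) (by norm_num)).tendsto.comp h1).const_mul w
    simp only [zero_add, Real.log_one, mul_zero] at h2
    refine h2.congr' ?_
    filter_upwards [eventually_gt_atTop (max 0 (-x))] with t ht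
    have h0 : 0 < t := lt_of_le_of_lt (le_max_left _ _) ht
    have hx0 : 0 < x + t := by
      have := lt_of_le_of_lt (le_max_right 0 (-x)) ht
      linarith
    simp only [Function.comp]
    rw [← Real.log_div hx0.ne' h0.ne']
    congr 2
    field_simp
  have hlim : Tendsto Φ atTop (nhds 0) := by
    have h1 : Tendsto (fun t => ∑ i, w i * (Real.log (x i + t) - Real.log t)
        - ∑ k, u k * (Real.log (z k + t) - Real.log t)) atTop (nhds (∑ i : I, 0 - ∑ k : J, 0)) :=
      (tendsto_finsetSum _ fun i _ => hlim1 _ _).sub (tendsto_finsetSum _ fun i _ => hlim1 _ _)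
    simp only [Finset.sum_const_zero, sub_zero] at h1
    refine h1.congr fun t => ?_
    simp only [hΦ, mul_sub, Finset.sum_sub_distrib, ← Finset.sum_mul, hsum]
    ring
  have h0 : Φ 0 ≤ 0 := by
    refine ge_of_tendsto hlim ?_
    filter_upwards [eventually_ge_atTop 0] with t ht
    exact hmono (Set.self_mem_Ici) ht ht
  simp only [hΦ, add_zero] at h0
  linarith

lemma gibbs_sum {J : Type*} [Fintype J] (γ z : J → ℝ) (Z g : ℝ) (hγ : ∀ k, 0 ≤ γ k)
    (hz : ∀ k, 0 ≤ z k) (hγz : ∀ k, γ k ≠ 0 → 0 < z k) (hg : ∑ k, γ k = g) (hZ : ∑ k, z k ≤ Z)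
    (hZ0 : 0 < Z) :
    ∑ k, γ k * (Real.log (z k) - Real.log (γ k)) ≤ g * (Real.log Z - Real.log g) := by
  by_cases hg0 : g = 0
  · have : ∀ k, γ k = 0 := by
      intro k
      rw [hg0] at hg
      exact (Finset.sum_eq_zero_iff_of_nonneg (fun i _ => hγ i)).1 hg k (Finset.mem_univ k)
    simp [this, hg0]
  have hgp : 0 < g := lt_of_le_of_ne (hg ▸ Finset.sum_nonneg fun i _ => hγ i) (Ne.symm hg0)
  have key : ∀ k, γ k * (Real.log (z k) - Real.log (γ k)) ≤
      γ k * (Real.log Z - Real.log g) + (z k * g / Z - γ k) := by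
    intro k
    by_cases h : γ k = 0
    · simp [h]
      have := hz k
      positivity
    have h1 := hγz k h
    have h2 : 0 < γ k := lt_of_le_of_ne (hγ k) (Ne.symm h)
    have h3 := Real.log_le_sub_one_of_pos (x := z k * g / (γ k * Z)) (by positivity)
    rw [Real.log_div (by positivity) (by positivity), Real.log_mul h1.ne' hgp.ne',
      Real.log_mul h2.ne' hZ0.ne'] at h3
    have h4 := mul_le_mul_of_nonneg_left h3 h2.le
    have h5 : γ k * (z k * g / (γ k * Z) - 1) = z k * g / Z - γ k := by field_simp
    rw [h5] at h4
    linarith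
  calc _ ≤ ∑ k, (γ k * (Real.log Z - Real.log g) + (z k * g / Z - γ k)) :=
        Finset.sum_le_sum fun k _ => key k
    _ = g * (Real.log Z - Real.log g) + ((∑ k, z k) * g / Z - g) := by
        rw [Finset.sum_add_distrib, Finset.sum_sub_distrib, ← Finset.sum_mul, hg,
          ← Finset.sum_div, ← Finset.sum_mul]
    _ ≤ _ := by
        have : (∑ k, z k) * g / Z ≤ g := by
          rw [div_le_iff₀ hZ0, mul_comm g]
          exact mul_le_mul_of_nonneg_right hZ hgp.le
        linarith

lemma log_two_le : Real.log 2 ≤ 2 / Real.exp 1 := by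
  rw [le_div_iff₀ (Real.exp_pos 1)]
  have h1 := Real.log_two_lt_d9
  have h2 := Real.exp_one_lt_d9
  have h3 := Real.log_two_gt_d9
  nlinarith

lemma two_bin_le (x : ℝ) (hx0 : 0 ≤ x) (hx1 : x ≤ 1) :
    2 * (-(1 - x) * Real.log (1 - x) - x * Real.log x) ≤ 2 / Real.exp 1 + x * Real.log 6 := by
  have h := gibbs_sum (J := Bool) (fun b => if b then 1 - x else x)
    (fun b => if b then 12/5 else 1) (17/5) 1 (by intro b; cases b <;> simp <;> linarith)
    (by intro b; cases b <;> norm_num) (by intro b; cases b <;> norm_num) (by simp)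
    (by norm_num) (by norm_num)
  simp at h
  have e1 : Real.log (17/5) ≤ Real.log (12/5) + 1 / Real.exp 1 := by
    have h1 : (0.367 : ℝ) ≤ 1 / Real.exp 1 := by
      rw [le_div_iff₀ (Real.exp_pos 1)]
      have h2 := Real.exp_one_lt_d9
      nlinarith
    have h2 := Real.quadratic_le_exp_of_nonneg (x := 0.367) (by norm_num)
    have h3 : Real.log (17/12) ≤ 0.367 := by
      rw [Real.log_le_iff_le_exp (by norm_num)]
      norm_num at h2 ⊢; linarith
    have h4 : Real.log (17/5) = Real.log (12/5) + Real.log (17/12) := by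
      rw [← Real.log_mul (by norm_num) (by norm_num)]; norm_num
    linarith
  have e2 : 2 * Real.log (12/5) ≤ Real.log 6 := by
    have : 2 * Real.log (12/5) = Real.log ((12/5)^2) := by rw [Real.log_pow]; norm_num
    rw [this]
    exact Real.log_le_log (by norm_num) (by norm_num)
  have e3 : 2 / Real.exp 1 = 2 * (1 / Real.exp 1) := by ring
  rw [e3]
  nlinarith [mul_le_mul_of_nonneg_left e2 hx0]



lemma entropy_eq_of_diag {ι : Type*} [Fintype ι] [DecidableEq ι] (ρ W : Matrix ι ι ℂ) (μ : ι → ℝ)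
    (hW : Wᴴ * W = 1) (h : ρ = W * diagonal (fun i => (μ i : ℂ)) * Wᴴ) :
    entropy ρ = -∑ i, μ i * Real.log (μ i) := by
  have hH : ρ.IsHermitian := by
    rw [h]
    refine isHermitian_mul_mul_conjTranspose _ ?_
    refine isHermitian_diagonal_of_self_adjoint _ ?_
    ext i
    simp
  have hc : ρ.charpoly = ∏ i, (Polynomial.X - Polynomial.C (μ i : ℂ)) := by
    rw [h, charpoly_mul_comm, ← mul_assoc, hW, one_mul, charpoly_diagonal]
  have hr : ρ.charpoly.roots = Multiset.map (fun i => (μ i : ℂ)) Finset.univ.val := by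
    rw [hc, Polynomial.roots_prod]
    · simp
    · simp [Finset.prod_ne_zero_iff, Polynomial.X_sub_C_ne_zero]
  rw [hH.roots_charpoly_eq_eigenvalues] at hr
  have h2 := congrArg (fun s => (Multiset.map (fun z : ℂ => z.re * Real.log z.re) s).sum) hr
  simp only [Multiset.map_map] at h2
  unfold entropy
  rw [dif_pos hH]
  congr 1

lemma spec {ι : Type*} [Fintype ι] [DecidableEq ι] {ρ : Matrix ι ι ℂ} (h : ρ.PosSemidef) :
    ∃ (U : Matrix ι ι ℂ) (l : ι → ℝ), Uᴴ * U = 1 ∧ U * Uᴴ = 1 ∧ (∀ i, 0 ≤ l i) ∧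
      ρ = U * diagonal (fun i => (l i : ℂ)) * Uᴴ ∧
      entropy ρ = -∑ i, l i * Real.log (l i) := by
  have h1 : (h.1.eigenvectorUnitary : Matrix ι ι ℂ)ᴴ * h.1.eigenvectorUnitary = 1 := by
    have := Unitary.coe_star_mul_self h.1.eigenvectorUnitary
    simpa [star_eq_conjTranspose] using this
  have h2 : (h.1.eigenvectorUnitary : Matrix ι ι ℂ) * (h.1.eigenvectorUnitary : Matrix ι ι ℂ)ᴴ = 1 := by
    have := Unitary.coe_mul_star_self h.1.eigenvectorUnitary
    simpa [star_eq_conjTranspose] using this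
  have h3 : ρ = h.1.eigenvectorUnitary * diagonal (fun i => (h.1.eigenvalues i : ℂ)) *
      (h.1.eigenvectorUnitary : Matrix ι ι ℂ)ᴴ := by
    have := h.1.spectral_theorem
    rw [Unitary.conjStarAlgAut_apply] at this
    exact this
  exact ⟨h.1.eigenvectorUnitary, h.1.eigenvalues, h1, h2, fun i => h.eigenvalues_nonneg i, h3,
    entropy_eq_of_diag _ _ _ h1 h3⟩

lemma tr_mul_nonneg {ι : Type*} [Fintype ι] [DecidableEq ι] {A B : Matrix ι ι ℂ}
    (hA : A.PosSemidef) (hB : B.PosSemidef) : 0 ≤ (A * B).trace.re := by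
  obtain ⟨U, l, h1, h2, h3, h4, -⟩ := spec hA
  have h5 : (A * B).trace = ∑ i, (l i : ℂ) * (Uᴴ * B * U) i i := by
    rw [h4, mul_assoc, mul_assoc, trace_mul_comm, mul_assoc, ← mul_assoc]
    simp only [trace, diag_apply, mul_assoc, diagonal_mul]
  rw [h5, Complex.re_sum]
  refine Finset.sum_nonneg fun i _ => ?_
  rw [Complex.re_ofReal_mul]
  refine mul_nonneg (h3 i) ?_
  have := (hB.conjTranspose_mul_mul_same U).diag_nonneg (i := i)
  exact (Complex.le_def.1 this).1

lemma tr_diag_conj {ι : Type*} [Fintype ι] [DecidableEq ι] (U X : Matrix ι ι ℂ) (l : ι → ℝ) :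
    (U * diagonal (fun i => (l i : ℂ)) * Uᴴ * X).trace.re = ∑ i, l i * ((Uᴴ * X * U) i i).re := by
  have h5 : (U * diagonal (fun i => (l i : ℂ)) * Uᴴ * X).trace
      = ∑ i, (l i : ℂ) * (Uᴴ * X * U) i i := by
    rw [mul_assoc, mul_assoc, trace_mul_comm, mul_assoc, ← mul_assoc]
    simp only [trace, diag_apply, mul_assoc, diagonal_mul]
  rw [h5, Complex.re_sum]
  simp

lemma povm_sq {ι κ : Type*} [Fintype ι] [DecidableEq ι] [Fintype κ]
    (τ : Matrix ι ι ℂ) (hτ : τ.PosSemidef)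
    (E : κ → Matrix ι ι ℂ) (hE : ∀ k, (E k).PosSemidef) (hE1 : ∑ k, E k = 1) (x : κ → ℝ) :
    (τ * ((∑ k, (x k : ℂ) • E k) * (∑ k, (x k : ℂ) • E k))).trace.re ≤
      ∑ k, x k ^ 2 * (τ * E k).trace.re := by
  set X := ∑ k, (x k : ℂ) • E k with hX
  have hXH : Xᴴ = X := by
    rw [hX, conjTranspose_sum]
    refine Finset.sum_congr rfl fun k _ => ?_
    rw [conjTranspose_smul, (hE k).1]
    simp
  have hid : ∑ k, (((x k : ℂ) • (1 : Matrix ι ι ℂ) - X)ᴴ * E k * ((x k : ℂ) • (1 : Matrix ι ι ℂ) - X))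
      = ∑ k, ((x k : ℂ)^2) • E k - X * X := by
    have h1 : ∀ k, (((x k : ℂ) • (1 : Matrix ι ι ℂ) - X)ᴴ * E k * ((x k : ℂ) • (1 : Matrix ι ι ℂ) - X))
      = ((x k : ℂ)^2) • E k - X * ((x k : ℂ) • E k) - ((x k : ℂ) • E k) * X + X * E k * X := by
      intro k
      rw [conjTranspose_sub, hXH, conjTranspose_smul, conjTranspose_one]
      simp only [sub_mul, mul_sub, smul_mul_assoc, mul_smul_comm, one_mul, mul_one, smul_smul,
        Complex.star_def, Complex.conj_ofReal, sq, smul_sub]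
      abel
    simp only [h1, Finset.sum_add_distrib, Finset.sum_sub_distrib, ← Finset.mul_sum,
      ← Finset.sum_mul, ← hX, hE1]
    simp
  have hpos : 0 ≤ (τ * ∑ k, (((x k : ℂ) • (1 : Matrix ι ι ℂ) - X)ᴴ * E k *
      ((x k : ℂ) • (1 : Matrix ι ι ℂ) - X))).trace.re := by
    rw [Finset.mul_sum, trace_sum, Complex.re_sum]
    exact Finset.sum_nonneg fun k _ => tr_mul_nonneg hτ ((hE k).conjTranspose_mul_mul_same _)
  rw [hid, mul_sub, trace_sub, Finset.mul_sum, trace_sum, Complex.sub_re, Complex.re_sum] at hpos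
  have h3 : ∀ k, (τ * ((x k : ℂ)^2 • E k)).trace.re = x k ^ 2 * (τ * E k).trace.re := by
    intro k
    rw [mul_smul_comm, trace_smul, smul_eq_mul, ← Complex.ofReal_pow, Complex.re_ofReal_mul]
  simp only [h3] at hpos
  linarith

lemma elem_ineq (l m t : ℝ) (z o : ℂ) (hl : 0 ≤ l) (hm : 0 ≤ m) (ht : 0 < t) :
    2 * (l * (z * star o).re) - m * Complex.normSq z - t * (l * Complex.normSq z)
      ≤ (l * Complex.normSq o) * l / (m + t * l) := by
  rcases eq_or_lt_of_le hl with h | h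
  · subst h
    simp
    exact mul_nonneg hm (Complex.normSq_nonneg z)
  have hp : 0 < m + t * l := by positivity
  rw [le_div_iff₀ hp]
  simp only [Complex.normSq_apply, Complex.mul_re, Complex.star_def, Complex.conj_re, Complex.conj_im]
  nlinarith [sq_nonneg ((m + t * l) * z.re - l * o.re), sq_nonneg ((m + t * l) * z.im - l * o.im)]

lemma measured_dpi {ι κ : Type*} [Fintype ι] [DecidableEq ι] [Fintype κ]
    (ρ : Matrix ι ι ℂ) (hρ : ρ.PosSemidef) (W : Matrix ι ι ℂ)
    (hW1 : Wᴴ * W = 1) (hW2 : W * Wᴴ = 1) (μ : ι → ℝ) (hμ : ∀ j, 0 ≤ μ j)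
    (hsupp : ∀ j, μ j = 0 → ((Wᴴ * ρ * W) j j).re = 0)
    (E : κ → Matrix ι ι ℂ) (hE : ∀ k, (E k).PosSemidef) (hE1 : ∑ k, E k = 1)
    (B a : κ → ℝ) (ha : ∀ k, (ρ * E k).trace.re = a k)
    (hB : ∀ k, (W * diagonal (fun i => (μ i : ℂ)) * Wᴴ * E k).trace.re ≤ B k)
    (hBpos : ∀ k, a k ≠ 0 → 0 < B k) :
    ∑ j, ((Wᴴ * ρ * W) j j).re * Real.log (μ j) + entropy ρ
      ≤ ∑ k, a k * (Real.log (B k) - Real.log (a k)) := by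
  obtain ⟨U, l, hU1, hU2, hl, hρU, hent⟩ := spec hρ
  set O := Uᴴ * W with hO
  have hOO : O * Oᴴ = 1 := by
    rw [hO, conjTranspose_mul, conjTranspose_conjTranspose, mul_assoc, ← mul_assoc W, hW2, one_mul,
      hU1]
  have hrow : ∀ i, ∑ j, Complex.normSq (O i j) = 1 := by
    intro i
    have := congrFun (congrFun hOO i) i
    rw [mul_apply] at this
    simp only [conjTranspose_apply, one_apply_eq, Complex.star_def, Complex.mul_conj] at this
    exact_mod_cast this
  have hdiag : ∀ j, ((Wᴴ * ρ * W) j j).re = ∑ i, l i * Complex.normSq (O i j) := by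
    intro j
    have : Wᴴ * ρ * W = Oᴴ * (diagonal (fun i => (l i : ℂ)) * O) := by
      rw [hρU, hO]; simp only [conjTranspose_mul, conjTranspose_conjTranspose, mul_assoc]
    rw [this, mul_apply, Complex.re_sum]
    refine Finset.sum_congr rfl fun i _ => ?_
    rw [diagonal_mul, conjTranspose_apply]
    have : star (O i j) * (↑(l i) * O i j) = ((l i * Complex.normSq (O i j) : ℝ) : ℂ) := by
      rw [Complex.ofReal_mul, ← Complex.mul_conj, Complex.star_def]; ring
    rw [this, Complex.ofReal_re]
  have ha0 : ∀ k, 0 ≤ a k := fun k => by rw [← ha]; exact tr_mul_nonneg hρ (hE k)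
  have hσ : (W * diagonal (fun i => (μ i : ℂ)) * Wᴴ).PosSemidef := by
    refine PosSemidef.mul_mul_conjTranspose_same ?_ W
    refine PosSemidef.diagonal ?_
    intro i
    simpa using hμ i
  have hB0 : ∀ k, 0 ≤ B k := fun k => (tr_mul_nonneg hσ (hE k)).trans (hB k)
  have hterm0 : ∀ i j, μ j = 0 → l i * Complex.normSq (O i j) = 0 := by
    intro i j hj
    have h1 := hsupp j hj
    rw [hdiag] at h1
    exact (Finset.sum_eq_zero_iff_of_nonneg (fun i _ => mul_nonneg (hl i) (Complex.normSq_nonneg _))).1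
      h1 i (Finset.mem_univ i)
  have htr : ∑ i, l i = ∑ k, a k := by
    have h1 : ∑ k, a k = (ρ * 1).trace.re := by
      rw [← hE1, Finset.mul_sum, trace_sum, Complex.re_sum]
      exact Finset.sum_congr rfl fun k _ => (ha k).symm
    rw [h1, hρU, tr_diag_conj]
    refine Finset.sum_congr rfl fun i _ => ?_
    simp [hU1]
  have main := log_sum_le_of_resolvent (I := ι × ι) (J := κ)
    (fun p => l p.1 * Complex.normSq (O p.1 p.2)) (fun p => μ p.2 / l p.1)
    a (fun k => B k / a k) (fun p => mul_nonneg (hl _) (Complex.normSq_nonneg _)) ha0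
    (fun p => div_nonneg (hμ _) (hl _)) (fun k => div_nonneg (hB0 k) (ha0 k))
    (by
      rintro ⟨i, j⟩ h
      simp only at h ⊢
      have h1 : l i ≠ 0 := left_ne_zero_of_mul h
      have h2 : μ j ≠ 0 := fun h0 => h (hterm0 i j h0)
      exact div_pos (lt_of_le_of_ne (hμ j) h2.symm) (lt_of_le_of_ne (hl i) h1.symm))
    (by
      intro k h
      exact div_pos (hBpos k h) (lt_of_le_of_ne (ha0 k) h.symm))
    (by
      rw [Fintype.sum_prod_type, ← htr]
      refine Finset.sum_congr rfl fun i _ => ?_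
      show ∑ j, l i * Complex.normSq (O i j) = l i
      rw [← Finset.mul_sum, hrow, mul_one])
    (by
      intro t ht
      set x : κ → ℝ := fun k => a k / (B k + t * a k) with hx
      set X := ∑ k, (x k : ℂ) • E k with hX
      have hXH : Xᴴ = X := by
        rw [hX, conjTranspose_sum]
        refine Finset.sum_congr rfl fun k _ => ?_
        rw [conjTranspose_smul, (hE k).1]
        simp
      have e1 : (ρ * X).trace.re = ∑ k, x k * a k := by
        rw [hX, Finset.mul_sum, trace_sum, Complex.re_sum]
        refine Finset.sum_congr rfl fun k _ => ?_
        rw [mul_smul_comm, trace_smul, smul_eq_mul, Complex.re_ofReal_mul, ha]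
      have e2 := povm_sq ρ hρ E hE hE1 x
      have e3 := povm_sq _ hσ E hE hE1 x
      rw [← hX] at e2 e3
      set Z := Uᴴ * X * W with hZ
      have f1 : (ρ * X).trace.re = ∑ p : ι × ι, l p.1 * (Z p.1 p.2 * star (O p.1 p.2)).re := by
        rw [hρU, tr_diag_conj, Fintype.sum_prod_type]
        refine Finset.sum_congr rfl fun i _ => ?_
        have : Uᴴ * X * U = Z * Oᴴ := by
          rw [hZ, hO, conjTranspose_mul, conjTranspose_conjTranspose, mul_assoc _ W,
            ← mul_assoc W, hW2, one_mul]
        rw [this, mul_apply, Complex.re_sum, Finset.mul_sum]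
        rfl
      have f2 : (ρ * (X * X)).trace.re = ∑ p : ι × ι, l p.1 * Complex.normSq (Z p.1 p.2) := by
        rw [hρU, tr_diag_conj, Fintype.sum_prod_type]
        refine Finset.sum_congr rfl fun i _ => ?_
        have : Uᴴ * (X * X) * U = Z * Zᴴ := by
          rw [hZ, conjTranspose_mul, conjTranspose_mul, conjTranspose_conjTranspose, hXH,
            mul_assoc _ W, ← mul_assoc W, hW2, one_mul]
          simp only [mul_assoc]
        rw [this, mul_apply, Complex.re_sum, Finset.mul_sum]
        refine Finset.sum_congr rfl fun j _ => ?_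
        rw [conjTranspose_apply, Complex.star_def, Complex.mul_conj, Complex.ofReal_re]
      have f3 : (W * diagonal (fun i => (μ i : ℂ)) * Wᴴ * (X * X)).trace.re
          = ∑ p : ι × ι, μ p.2 * Complex.normSq (Z p.1 p.2) := by
        rw [tr_diag_conj, Fintype.sum_prod_type_right]
        refine Finset.sum_congr rfl fun i _ => ?_
        have : Wᴴ * (X * X) * W = Zᴴ * Z := by
          rw [hZ, conjTranspose_mul, conjTranspose_mul, conjTranspose_conjTranspose, hXH]
          have : Wᴴ * (X * U) * (Uᴴ * X * W) = Wᴴ * X * (U * Uᴴ) * X * W := by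
            simp only [mul_assoc]
          rw [this, hU2]
          simp only [mul_assoc, one_mul, mul_one]
        rw [this, mul_apply, Complex.re_sum, Finset.mul_sum]
        refine Finset.sum_congr rfl fun j _ => ?_
        rw [conjTranspose_apply, Complex.star_def, mul_comm (starRingEnd ℂ _), Complex.mul_conj,
          Complex.ofReal_re]
      have g1 : ∑ k, a k / (B k / a k + t) ≤
          2 * (ρ * X).trace.re - (W * diagonal (fun i => (μ i : ℂ)) * Wᴴ * (X * X)).trace.re
           - t * (ρ * (X * X)).trace.re := by
        have : ∑ k, a k / (B k / a k + t) ≤ 2 * ∑ k, x k * a k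
          - ∑ k, x k ^ 2 * (W * diagonal (fun i => (μ i : ℂ)) * Wᴴ * E k).trace.re
          - t * ∑ k, x k ^ 2 * (ρ * E k).trace.re := by
          rw [Finset.mul_sum, Finset.mul_sum, ← Finset.sum_sub_distrib, ← Finset.sum_sub_distrib]
          refine Finset.sum_le_sum fun k _ => ?_
          rw [ha]
          have hb := mul_le_mul_of_nonneg_left (hB k) (sq_nonneg (x k))
          rcases eq_or_lt_of_le (ha0 k) with h | h
          · have : x k = 0 := by simp [hx, ← h]
            simp [← h, this]
          · have hp : 0 < B k + t * a k := by have := hB0 k; positivity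
            have hq : a k / (B k / a k + t) = 2 * (x k * a k) - x k ^2 * B k - t * (x k ^2 * a k) := by
              have hx1 : x k * (B k + t * a k) = a k := by
                simp only [hx]; exact div_mul_cancel₀ _ hp.ne'
              have hh : a k / (B k / a k + t) = x k * a k := by
                simp only [hx]
                have : B k / a k + t = (B k + t * a k) / a k := by field_simp
                rw [this, div_div_eq_mul_div, div_mul_eq_mul_div]
              rw [hh]
              linear_combination (x k) * hx1
            rw [hq]
            linarith
        have ht2 := mul_le_mul_of_nonneg_left e2 ht.le
        rw [e1]
        linarith
      refine g1.trans ?_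
      rw [f1, f2, f3, Finset.mul_sum, Finset.mul_sum, ← Finset.sum_sub_distrib,
        ← Finset.sum_sub_distrib]
      refine Finset.sum_le_sum fun p _ => ?_
      have h1 := elem_ineq (l p.1) (μ p.2) t (Z p.1 p.2) (O p.1 p.2) (hl _) (hμ _) ht
      refine h1.trans (le_of_eq ?_)
      rcases eq_or_lt_of_le (hl p.1) with h | h
      · simp [← h]
      · field_simp)
  have hL : ∑ p : ι × ι, l p.1 * Complex.normSq (O p.1 p.2) * Real.log (μ p.2 / l p.1)
      = ∑ j, ((Wᴴ * ρ * W) j j).re * Real.log (μ j) + entropy ρ := by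
    have h1 : ∀ p : ι × ι, l p.1 * Complex.normSq (O p.1 p.2) * Real.log (μ p.2 / l p.1)
        = l p.1 * Complex.normSq (O p.1 p.2) * Real.log (μ p.2)
          - Complex.normSq (O p.1 p.2) * (l p.1 * Real.log (l p.1)) := by
      rintro ⟨i, j⟩
      simp only
      by_cases h : l i * Complex.normSq (O i j) = 0
      · rw [h]
        rcases mul_eq_zero.1 h with h | h <;> simp [h]
      · have h1 : l i ≠ 0 := left_ne_zero_of_mul h
        have h2 : μ j ≠ 0 := fun h0 => h (hterm0 i j h0)
        rw [Real.log_div h2 h1]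
        ring
    simp only [h1, Finset.sum_sub_distrib]
    rw [Fintype.sum_prod_type_right, Fintype.sum_prod_type, hent, ← sub_eq_add_neg]
    congr 1
    · refine Finset.sum_congr rfl fun j _ => ?_
      rw [hdiag, Finset.sum_mul]
    · refine Finset.sum_congr rfl fun i _ => ?_
      show ∑ j, Complex.normSq (O i j) * (l i * Real.log (l i)) = _
      rw [← Finset.sum_mul, hrow, one_mul]
  rw [hL] at main
  refine main.trans (le_of_eq ?_)
  refine Finset.sum_congr rfl fun k _ => ?_
  by_cases h : a k = 0
  · simp [h]
  · rw [Real.log_div (hBpos k h).ne' h]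



lemma traceNorm_ge {ι : Type*} [Fintype ι] [DecidableEq ι] (ω : Matrix ι ι ℂ) (i0 : ι)
    (htr : ω.trace = 0) : -2 * (ω i0 i0).re ≤ traceNorm ω := by
  have h := Matrix.posSemidef_conjTranspose_mul_self ω
  set U : Matrix ι ι ℂ := (h.1.eigenvectorUnitary : Matrix ι ι ℂ) with hU
  set l := h.1.eigenvalues with hl
  have hU1 : Uᴴ * U = 1 := by
    have := Unitary.coe_star_mul_self h.1.eigenvectorUnitary
    simpa [star_eq_conjTranspose] using this
  have hU2 : U * Uᴴ = 1 := by
    have := Unitary.coe_mul_star_self h.1.eigenvectorUnitary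
    simpa [star_eq_conjTranspose] using this
  have hsp : ωᴴ * ω = U * diagonal (fun i => (l i : ℂ)) * Uᴴ := by
    have := h.1.spectral_theorem
    rw [Unitary.conjStarAlgAut_apply] at this
    exact this
  have htn : traceNorm ω = ∑ i, Real.sqrt (l i) := by
    have : traceNorm ω = (U * diagonal (fun i => (Real.sqrt (l i) : ℂ)) * Uᴴ).trace.re := rfl
    rw [this, trace_mul_comm, ← mul_assoc, hU1, one_mul, trace_diagonal, Complex.re_sum]
    simp
  set s : ι → ℂ := fun i => if i = i0 then -1 else 1 with hs
  set R : Matrix ι ι ℂ := diagonal s with hR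
  have hRR : R * Rᴴ = 1 := by
    rw [hR, diagonal_conjTranspose, diagonal_mul_diagonal, ← diagonal_one]
    congr 1
    ext i
    by_cases hi : i = i0 <;> simp [hs, hi]
  have e1 : (R * ω).trace.re = -2 * (ω i0 i0).re := by
    have h1 : (R * ω).trace = ω.trace - 2 * ω i0 i0 := by
      rw [trace, trace]
      simp only [hR, diag_apply, diagonal_mul]
      have : ∀ i, s i * ω i i = ω i i - (if i = i0 then 2 * ω i0 i0 else 0) := by
        intro i
        by_cases hi : i = i0
        · subst hi; simp [hs]; ring
        · simp [hs, hi]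
      simp only [this, Finset.sum_sub_distrib]
      simp
    rw [h1, htr]
    simp
  have e2 : (R * ω).trace = ∑ i, ∑ k, (Uᴴ * R) i k * (ω * U) k i := by
    have : (R * ω).trace = ((Uᴴ * R) * (ω * U)).trace := by
      have h3 : (Uᴴ * R) * (ω * U) = Uᴴ * ((R * ω) * U) := by simp only [mul_assoc]
      rw [h3, trace_mul_comm Uᴴ, mul_assoc, hU2, mul_one]
    rw [this, trace]
    rfl
  rw [← e1, e2, htn, Complex.re_sum]
  refine Finset.sum_le_sum fun i _ => ?_
  have n1 : ∑ k, ‖(Uᴴ * R) i k‖ ^ 2 = 1 := by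
    have h1 : (Uᴴ * R) * (Uᴴ * R)ᴴ = 1 := by
      rw [conjTranspose_mul, conjTranspose_conjTranspose, mul_assoc, ← mul_assoc R, hRR, one_mul, hU1]
    have := congrFun (congrFun h1 i) i
    rw [mul_apply] at this
    simp only [conjTranspose_apply, one_apply_eq, Complex.star_def, Complex.mul_conj,
      Complex.normSq_eq_norm_sq] at this
    exact_mod_cast this
  have n2 : ∑ k, ‖(ω * U) k i‖ ^ 2 = l i := by
    have h1 : (ω * U)ᴴ * (ω * U) = diagonal (fun i => (l i : ℂ)) := by
      have : (ω * U)ᴴ * (ω * U) = Uᴴ * (ωᴴ * ω) * U := by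
        rw [conjTranspose_mul]; simp only [mul_assoc]
      rw [this, hsp]
      have : Uᴴ * (U * diagonal (fun i => (l i : ℂ)) * Uᴴ) * U
        = (Uᴴ * U) * diagonal (fun i => (l i : ℂ)) * (Uᴴ * U) := by simp only [mul_assoc]
      rw [this, hU1, one_mul, mul_one]
    have := congrFun (congrFun h1 i) i
    rw [mul_apply] at this
    simp only [conjTranspose_apply, diagonal_apply_eq, Complex.star_def, mul_comm (starRingEnd ℂ _),
      Complex.mul_conj, Complex.normSq_eq_norm_sq] at this
    exact_mod_cast this
  calc (∑ k, (Uᴴ * R) i k * (ω * U) k i).re ≤ ‖∑ k, (Uᴴ * R) i k * (ω * U) k i‖ :=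
        Complex.re_le_norm _
    _ ≤ ∑ k, ‖(Uᴴ * R) i k * (ω * U) k i‖ := norm_sum_le _ _
    _ = ∑ k, ‖(Uᴴ * R) i k‖ * ‖(ω * U) k i‖ := by simp
    _ ≤ Real.sqrt (∑ k, ‖(Uᴴ * R) i k‖ ^ 2) * Real.sqrt (∑ k, ‖(ω * U) k i‖ ^ 2) :=
        Real.sum_mul_le_sqrt_mul_sqrt _ _ _
    _ = Real.sqrt (l i) := by rw [n1, n2]; simp

lemma tr_sub_psd {ι : Type*} [Fintype ι] [DecidableEq ι] {M : Matrix ι ι ℂ} (h : M.PosSemidef) :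
    ((M.trace.re : ℂ) • (1 : Matrix ι ι ℂ) - M).PosSemidef := by
  obtain ⟨U, l, h1, h2, h3, h4, -⟩ := spec h
  have ht : M.trace.re = ∑ i, l i := by
    rw [h4, trace_mul_comm, ← mul_assoc, h1, one_mul, trace_diagonal, Complex.re_sum]
    simp
  have : (M.trace.re : ℂ) • (1 : Matrix ι ι ℂ) - M
      = U * diagonal (fun i => ((M.trace.re - l i : ℝ) : ℂ)) * Uᴴ := by
    have h5 : diagonal (fun i => ((M.trace.re - l i : ℝ) : ℂ))
        = (M.trace.re : ℂ) • (1 : Matrix ι ι ℂ) - diagonal (fun i => (l i : ℂ)) := by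
      ext i j
      by_cases hij : i = j
      · subst hij; simp
      · simp [hij]
    rw [h5, mul_sub, sub_mul, ← h4]
    simp [h2]
  rw [this]
  refine PosSemidef.mul_mul_conjTranspose_same ?_ U
  refine PosSemidef.diagonal fun i => ?_
  have : l i ≤ M.trace.re := by
    rw [ht]; exact Finset.single_le_sum (fun i _ => h3 i) (Finset.mem_univ i)
  have h6 : (0:ℝ) ≤ M.trace.re - l i := by linarith
  show (0:ℂ) ≤ ((M.trace.re - l i : ℝ) : ℂ)
  exact_mod_cast h6

lemma tr_nonneg {ι : Type*} [Fintype ι] [DecidableEq ι] {M : Matrix ι ι ℂ} (h : M.PosSemidef) :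
    0 ≤ M.trace.re := (Complex.le_def.1 h.trace_nonneg).1

lemma tr_mul_le {ι : Type*} [Fintype ι] [DecidableEq ι] {P M : Matrix ι ι ℂ} (hP : P.PosSemidef)
    (h : (1 - M).PosSemidef) : (P * M).trace.re ≤ P.trace.re := by
  have := tr_mul_nonneg hP h
  rw [mul_sub, mul_one, trace_sub, Complex.sub_re] at this
  linarith

lemma tr_mul_le' {ι : Type*} [Fintype ι] [DecidableEq ι] {P M : Matrix ι ι ℂ} (hP : P.PosSemidef)
    (h : M.PosSemidef) : (P * M).trace.re ≤ M.trace.re * P.trace.re := by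
  have := tr_mul_nonneg hP (tr_sub_psd h)
  rw [mul_sub, mul_smul_comm, mul_one, trace_sub, trace_smul, Complex.sub_re, smul_eq_mul,
    Complex.re_ofReal_mul] at this
  linarith

lemma ent_le {ι κ : Type*} [Fintype ι] [DecidableEq ι] [Fintype κ]
    (ρ : Matrix ι ι ℂ) (hρ : ρ.PosSemidef)
    (E : κ → Matrix ι ι ℂ) (hE : ∀ k, (E k).PosSemidef) (hE1 : (1 - ∑ k, E k).PosSemidef)
    (B a : κ → ℝ) (ha : ∀ k, (ρ * E k).trace.re = a k)
    (hB : ∀ k, (E k).trace.re ≤ B k) (hBpos : ∀ k, a k ≠ 0 → 0 < B k)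
    (x Bx : ℝ) (hx : ρ.trace.re - ∑ k, a k = x) (hBx : (1 - ∑ k, E k).trace.re ≤ Bx)
    (hBxpos : x ≠ 0 → 0 < Bx) :
    entropy ρ ≤ ∑ k, a k * (Real.log (B k) - Real.log (a k)) + x * (Real.log Bx - Real.log x) := by
  have := measured_dpi ρ hρ 1 (by simp) (by simp) (fun _ => 1) (by simp) (by simp)
    (fun k : Option κ => k.elim (1 - ∑ k, E k) E)
    (by rintro (_|k); exacts [hE1, hE k]) (by rw [Fintype.sum_option]; simp)
    (fun k : Option κ => k.elim Bx B) (fun k : Option κ => k.elim x a)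
    (by
      rintro (_|k)
      · simp only [Option.elim]
        rw [mul_sub, mul_one, trace_sub, Finset.mul_sum, trace_sum, Complex.sub_re, Complex.re_sum,
          ← hx]
        simp only [ha]
      · exact ha k)
    (by rintro (_|k) <;> simp <;> [simpa using hBx; exact hB k])
    (by rintro (_|k); exacts [hBxpos, hBpos k])
  rw [Fintype.sum_option] at this
  simp only [Option.elim] at this
  simp at this
  linarith

lemma condent_le {Y b κ : Type*} [Fintype Y] [DecidableEq Y] [Fintype b] [DecidableEq b] [Fintype κ]
    (τ : Matrix (Y × b) (Y × b) ℂ) (hτ : τ.PosSemidef) (hτY : (ptraceRight τ).PosSemidef)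
    (E : κ → Matrix (Y × b) (Y × b) ℂ) (hE : ∀ k, (E k).PosSemidef)
    (hE1 : (1 - ∑ k, E k).PosSemidef)
    (B a : κ → ℝ) (ha : ∀ k, (τ * E k).trace.re = a k)
    (hB : ∀ k, ((ptraceRight τ ⊗ₖ (1 : Matrix b b ℂ)) * E k).trace.re ≤ B k)
    (hBpos : ∀ k, a k ≠ 0 → 0 < B k)
    (x Bx : ℝ) (hx : τ.trace.re - ∑ k, a k = x)
    (hBx : ((ptraceRight τ ⊗ₖ (1 : Matrix b b ℂ)) * (1 - ∑ k, E k)).trace.re ≤ Bx)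
    (hBxpos : x ≠ 0 → 0 < Bx) :
    entropy τ - entropy (ptraceRight τ)
      ≤ ∑ k, a k * (Real.log (B k) - Real.log (a k)) + x * (Real.log Bx - Real.log x) := by
  obtain ⟨U, l, h1, h2, h3, h4, h5⟩ := spec hτY
  set W : Matrix (Y × b) (Y × b) ℂ := U ⊗ₖ (1 : Matrix b b ℂ) with hW
  have hWH : Wᴴ = Uᴴ ⊗ₖ (1 : Matrix b b ℂ) := by rw [hW, conjTranspose_kronecker, conjTranspose_one]
  have hW1 : Wᴴ * W = 1 := by
    rw [hWH, hW, ← mul_kronecker_mul, h1, mul_one, one_kronecker_one]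
  have hW2 : W * Wᴴ = 1 := by
    rw [hWH, hW, ← mul_kronecker_mul, h2, mul_one, one_kronecker_one]
  have hWd : W * diagonal (fun i : Y × b => (l i.1 : ℂ)) * Wᴴ
      = ptraceRight τ ⊗ₖ (1 : Matrix b b ℂ) := by
    have : diagonal (fun i : Y × b => (l i.1 : ℂ))
        = diagonal (fun i => (l i : ℂ)) ⊗ₖ (1 : Matrix b b ℂ) := by
      rw [← diagonal_one, diagonal_kronecker_diagonal]
      simp
    rw [this, hWH, hW, ← mul_kronecker_mul, ← mul_kronecker_mul, ← h4]
    simp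
  have hWpsd : (Wᴴ * τ * W).PosSemidef := hτ.conjTranspose_mul_mul_same W
  have hpos : ∀ p, 0 ≤ ((Wᴴ * τ * W) p p).re := fun p => (Complex.le_def.1 hWpsd.diag_nonneg).1
  have hsum : ∀ j, ∑ c, ((Wᴴ * τ * W) (j, c) (j, c)).re = l j := by
    intro j
    have e1 : Uᴴ * ptraceRight τ * U = diagonal (fun i => (l i : ℂ)) := by
      rw [h4]
      have : Uᴴ * (U * diagonal (fun i => (l i : ℂ)) * Uᴴ) * U
        = (Uᴴ * U) * diagonal (fun i => (l i : ℂ)) * (Uᴴ * U) := by simp only [mul_assoc]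
      rw [this, h1, one_mul, mul_one]
    have e2 : (Uᴴ * ptraceRight τ * U) j j = ∑ c, (Wᴴ * τ * W) (j, c) (j, c) := by
      rw [hWH, hW]
      simp only [mul_apply, Fintype.sum_prod_type, kroneckerMap_apply, ptraceRight, one_apply,
        mul_ite, mul_one, mul_zero, ite_mul, zero_mul, Finset.sum_ite_eq, Finset.sum_ite_eq',
        Finset.mem_univ, if_true, Finset.mul_sum, Finset.sum_mul]
      conv_rhs => rw [Finset.sum_comm]
      refine Finset.sum_congr rfl fun _ _ => ?_
      rw [Finset.sum_comm]
    rw [← Complex.re_sum, ← e2, e1]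
    simp
  have := measured_dpi τ hτ W hW1 hW2 (fun i => l i.1) (fun i => h3 _)
    (by
      rintro ⟨j, c⟩ hj
      have h0 := hsum j
      rw [hj] at h0
      exact (Finset.sum_eq_zero_iff_of_nonneg (fun i _ => hpos _)).1 h0 c (Finset.mem_univ c))
    (fun k : Option κ => k.elim (1 - ∑ k, E k) E)
    (by rintro (_|k); exacts [hE1, hE k]) (by rw [Fintype.sum_option]; simp)
    (fun k : Option κ => k.elim Bx B) (fun k : Option κ => k.elim x a)
    (by
      rintro (_|k)
      · simp only [Option.elim]
        rw [mul_sub, mul_one, trace_sub, Finset.mul_sum, trace_sum, Complex.sub_re, Complex.re_sum,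
          ← hx]
        simp only [ha]
      · exact ha k)
    (by rw [hWd]; rintro (_|k); exacts [hBx, hB k])
    (by rintro (_|k); exacts [hBxpos, hBpos k])
  rw [Fintype.sum_option] at this
  simp only [Option.elim] at this
  have h7 : ∑ j, ((Wᴴ * τ * W) j j).re * Real.log (l j.1) = ∑ j, l j * Real.log (l j) := by
    rw [Fintype.sum_prod_type]
    refine Finset.sum_congr rfl fun j _ => ?_
    show ∑ c, ((Wᴴ * τ * W) (j, c) (j, c)).re * Real.log (l j) = _
    rw [← Finset.sum_mul, hsum]
  rw [h7] at this
  linarith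



lemma diag_psd {I : Type*} [Fintype I] [DecidableEq I] (d : I → ℝ) (hd : ∀ i, 0 ≤ d i) :
    (diagonal (fun i => (d i : ℂ))).PosSemidef := by
  refine PosSemidef.diagonal fun i => ?_
  show (0:ℂ) ≤ (d i : ℂ)
  exact_mod_cast hd i

lemma tr_conj_diag {I a : Type*} [Fintype I] [DecidableEq I] [Fintype a]
    (V : Matrix I a ℂ) (X : Matrix a a ℂ) (d : I → ℝ) :
    (X * (Vᴴ * diagonal (fun i => (d i : ℂ)) * V)).trace.re = ∑ i, d i * ((V * X * Vᴴ) i i).re := by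
  have h : (X * (Vᴴ * diagonal (fun i => (d i : ℂ)) * V)).trace
      = (diagonal (fun i => (d i : ℂ)) * (V * X * Vᴴ)).trace := by
    have h1 : X * (Vᴴ * diagonal (fun i => (d i : ℂ)) * V)
        = (X * Vᴴ) * (diagonal (fun i => (d i : ℂ)) * V) := by simp only [Matrix.mul_assoc]
    rw [h1, trace_mul_comm, Matrix.mul_assoc, Matrix.mul_assoc]
  rw [h, trace, Complex.re_sum]
  refine Finset.sum_congr rfl fun i _ => ?_
  rw [diag_apply, diagonal_mul, Complex.re_ofReal_mul]

lemma proj_le {I a : Type*} [Fintype I] [DecidableEq I] [Fintype a] [DecidableEq a]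
    (V : Matrix I a ℂ) (hV : Vᴴ * V = 1) (i : I) :
    0 ≤ ((V * Vᴴ) i i).re ∧ ((V * Vᴴ) i i).re ≤ 1 := by
  have h1 : (V * Vᴴ).PosSemidef := posSemidef_self_mul_conjTranspose V
  have h2 : (1 - V * Vᴴ).PosSemidef := by
    have : 1 - V * Vᴴ = (1 - V * Vᴴ) * (1 - V * Vᴴ)ᴴ := by
      rw [conjTranspose_sub, conjTranspose_one, conjTranspose_mul, conjTranspose_conjTranspose,
        sub_mul, mul_sub, mul_sub, one_mul, mul_one, one_mul]
      have : V * Vᴴ * (V * Vᴴ) = V * (Vᴴ * V) * Vᴴ := by simp only [Matrix.mul_assoc]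
      rw [this, hV, Matrix.mul_one, sub_self, sub_zero]
    rw [this]
    exact posSemidef_self_mul_conjTranspose _
  have h3 := (Complex.le_def.1 (h1.diag_nonneg (i := i))).1
  have h4 := (Complex.le_def.1 (h2.diag_nonneg (i := i))).1
  refine ⟨h3, ?_⟩
  simp at h4
  simpa using h4

lemma alice {I a κ : Type*} [Fintype I] [DecidableEq I] [Fintype a] [DecidableEq a] [Fintype κ]
    (σ : Matrix a a ℂ) (hσ : σ.PosSemidef) (hσ1 : σ.trace = 1)
    (V : Matrix I a ℂ) (hV : Vᴴ * V = 1)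
    (d : κ → I → ℝ) (hd : ∀ k i, 0 ≤ d k i) (hd1 : ∀ i, ∑ k, d k i ≤ 1)
    (B c : κ → ℝ) (hc : ∀ k, ∑ i, d k i * ((V * σ * Vᴴ) i i).re = c k)
    (hB : ∀ k, ∑ i, d k i * ((V * Vᴴ) i i).re ≤ B k) (hBpos : ∀ k, c k ≠ 0 → 0 < B k)
    (x Bx : ℝ) (hx : 1 - ∑ k, c k = x)
    (hBx : (Fintype.card a : ℝ) - ∑ k, ∑ i, d k i * ((V * Vᴴ) i i).re ≤ Bx)
    (hBxpos : x ≠ 0 → 0 < Bx) :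
    entropy σ ≤ ∑ k, c k * (Real.log (B k) - Real.log (c k)) + x * (Real.log Bx - Real.log x) := by
  have htr : ∀ k, (Vᴴ * diagonal (fun i => (d k i : ℂ)) * V).trace.re
      = ∑ i, d k i * ((V * Vᴴ) i i).re := by
    intro k
    have := tr_conj_diag V 1 (d k)
    simpa using this
  refine ent_le σ hσ (fun k => Vᴴ * diagonal (fun i => (d k i : ℂ)) * V)
    (fun k => (diag_psd _ (hd k)).conjTranspose_mul_mul_same V) ?_ B c ?_ ?_ hBpos x Bx ?_ ?_ hBxpos
  · have : 1 - ∑ k, Vᴴ * diagonal (fun i => (d k i : ℂ)) * V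
        = Vᴴ * diagonal (fun i => ((1 - ∑ k, d k i : ℝ) : ℂ)) * V := by
      have h5 : diagonal (fun i => ((1 - ∑ k, d k i : ℝ) : ℂ))
        = (1 : Matrix I I ℂ) - ∑ k, diagonal (fun i => (d k i : ℂ)) := by
        ext i j
        by_cases hij : i = j
        · subst hij; simp [Matrix.sum_apply]
        · simp [hij, Matrix.sum_apply]
      rw [h5, Matrix.mul_sub, Matrix.sub_mul, Matrix.mul_one, hV, Matrix.mul_sum, Matrix.sum_mul]
    rw [this]
    exact (diag_psd _ (fun i => sub_nonneg.2 (hd1 i))).conjTranspose_mul_mul_same V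
  · intro k
    rw [tr_conj_diag, hc]
  · intro k
    rw [htr]; exact hB k
  · rw [hσ1, ← hx]; simp
  · rw [trace_sub, trace_sum, trace_one, Complex.sub_re, Complex.re_sum]
    simp only [htr]
    simpa using hBx

lemma tr_block {Y b : Type*} [Fintype Y] [DecidableEq Y] [Fintype b] [DecidableEq b]
    (τ : Matrix (Y × b) (Y × b) ℂ) (N : Matrix b b ℂ) (y : Y) :
    (τ * (diagonal (fun j => ((if j = y then 1 else 0 : ℝ) : ℂ)) ⊗ₖ N)).trace
      = (τ.submatrix (Prod.mk y) (Prod.mk y) * N).trace := by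
  simp only [trace, diag_apply, mul_apply, Fintype.sum_prod_type, kroneckerMap_apply,
    diagonal_apply, submatrix_apply]
  simp only [ite_mul, zero_mul, mul_ite, mul_zero, Complex.ofReal_one, Complex.ofReal_zero]
  rw [Finset.sum_eq_single y]
  · refine Finset.sum_congr rfl fun c _ => ?_
    rw [Finset.sum_eq_single y]
    · simp
    · intro j _ hj
      simp [hj]
    · simp
  · intro j _ hj
    refine Finset.sum_eq_zero fun c _ => ?_
    refine Finset.sum_eq_zero fun j' _ => ?_
    refine Finset.sum_eq_zero fun c' _ => ?_
    by_cases h : j' = j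
    · subst h; simp [hj]
    · simp [h]
  · simp

lemma bob {Y b : Type*} [Fintype Y] [DecidableEq Y] [Fintype b] [DecidableEq b] [Nonempty b]
    (τ : Matrix (Y × b) (Y × b) ℂ) (hτ : τ.PosSemidef) (hτY : (ptraceRight τ).PosSemidef)
    (hτ1 : τ.trace = 1)
    (M : Y → Matrix b b ℂ) (hM : ∀ y, (M y).PosSemidef) (hM1 : ∀ y, (1 - M y).PosSemidef)
    (s : Y → ℝ) (hs0 : ∀ y, 0 ≤ s y) (hs1 : ∀ y, s y ≤ 1)
    (c : Y → ℝ) (hc : ∀ y, s y * (τ.submatrix (Prod.mk y) (Prod.mk y) * M y).trace.re = c y)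
    (x : ℝ) (hx : 1 - ∑ y, c y = x) :
    entropy τ - entropy (ptraceRight τ)
      ≤ ∑ y, c y * (Real.log ((ptraceRight τ y y).re * (M y).trace.re) - Real.log (c y))
        + x * (Real.log (Fintype.card b) - Real.log x) := by
  have hp : ∀ y, (τ.submatrix (Prod.mk y) (Prod.mk y)).trace.re = (ptraceRight τ y y).re := by
    intro y; rfl
  have hP : ∀ y, (τ.submatrix (Prod.mk y) (Prod.mk y)).PosSemidef := fun y => hτ.submatrix _
  have hp0 : ∀ y, 0 ≤ (ptraceRight τ y y).re := fun y => by rw [← hp]; exact tr_nonneg (hP y)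
  have hpsum : ∑ y, (ptraceRight τ y y).re = 1 := by
    have : (τ.trace).re = ∑ y, (ptraceRight τ y y).re := by
      simp only [trace, diag_apply, Fintype.sum_prod_type, ptraceRight, Complex.re_sum]
    rw [← this, hτ1]; simp
  set D : Y → Matrix Y Y ℂ := fun y => diagonal (fun j => ((if j = y then 1 else 0 : ℝ) : ℂ)) with hD
  have hDp : ∀ y, (D y).PosSemidef := fun y => diag_psd _ (fun j => by split_ifs <;> norm_num)
  have hDs : ∑ y, D y = 1 := by
    ext i j
    by_cases hij : i = j
    · subst hij; simp [hD, Matrix.sum_apply, apply_ite Complex.ofReal]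
    · simp [hij, hD, Matrix.sum_apply]
  have hsM : ∀ y, ((s y : ℂ) • M y).PosSemidef := fun y =>
    (hM y).smul (by exact_mod_cast hs0 y)
  have hsM1 : ∀ y, (1 - (s y : ℂ) • M y).PosSemidef := fun y => by
    have : 1 - (s y : ℂ) • M y = (1 - M y) + ((1 - s y : ℝ) : ℂ) • M y := by
      rw [Complex.ofReal_sub, sub_smul]; simp
    rw [this]
    exact (hM1 y).add ((hM y).smul (by exact_mod_cast sub_nonneg.2 (hs1 y)))
  have hbad : 1 - ∑ y, D y ⊗ₖ ((s y : ℂ) • M y) = ∑ y, D y ⊗ₖ (1 - (s y : ℂ) • M y) := by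
    have h1 : ∀ y, D y ⊗ₖ (1 - (s y : ℂ) • M y)
        = D y ⊗ₖ (1 : Matrix b b ℂ) - D y ⊗ₖ ((s y : ℂ) • M y) := by
      intro y
      ext i j
      simp [kroneckerMap_apply, mul_sub]
    have h2 : ∑ y, D y ⊗ₖ (1 : Matrix b b ℂ) = 1 := by
      rw [← one_kronecker_one, ← hDs]
      ext i j
      simp [kroneckerMap_apply, Matrix.sum_apply, Finset.sum_mul]
    simp only [h1, Finset.sum_sub_distrib, h2]
  have htrY : ∀ y (N : Matrix b b ℂ), ((ptraceRight τ ⊗ₖ (1 : Matrix b b ℂ)) * (D y ⊗ₖ N)).trace.re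
      = (ptraceRight τ y y).re * N.trace.re := by
    intro y N
    have him : (ptraceRight τ y y).im = 0 := by
      have := (Complex.le_def.1 (hτY.diag_nonneg (i := y))).2
      simpa using this.symm
    rw [← mul_kronecker_mul, trace_kronecker, one_mul]
    have : (ptraceRight τ * D y).trace = ptraceRight τ y y := by
      simp [hD, trace, apply_ite Complex.ofReal]
    rw [this, Complex.mul_re, him]; ring
  have htrM : ∀ y, 0 ≤ (M y).trace.re := fun y => tr_nonneg (hM y)
  refine condent_le τ hτ hτY (fun y => D y ⊗ₖ ((s y : ℂ) • M y))
    (fun y => (hDp y).kronecker (hsM y)) ?_ _ c ?_ ?_ ?_ x _ ?_ ?_ ?_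
  · rw [hbad]
    exact posSemidef_sum _ (fun y _ => (hDp y).kronecker (hsM1 y))
  · intro y
    rw [tr_block, mul_smul_comm, trace_smul, smul_eq_mul, Complex.re_ofReal_mul, hc]
  · intro y
    rw [htrY, trace_smul, smul_eq_mul, Complex.re_ofReal_mul]
    refine mul_le_mul_of_nonneg_left ?_ (hp0 y)
    nlinarith [htrM y, hs1 y]
  · intro y hy
    have h1 := tr_mul_le' (hP y) (hM y)
    have h2 := tr_mul_nonneg (hP y) (hM y)
    rw [hp] at h1
    have h3 : (τ.submatrix (Prod.mk y) (Prod.mk y) * M y).trace.re ≠ 0 := by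
      intro h; apply hy; rw [← hc, h, mul_zero]
    have h4 := lt_of_le_of_ne h2 h3.symm
    rw [mul_comm]; linarith
  · rw [hτ1, ← hx]; simp
  · rw [hbad, Finset.mul_sum, trace_sum, Complex.re_sum]
    simp only [htrY]
    have : ∀ y, (ptraceRight τ y y).re * (1 - (s y : ℂ) • M y).trace.re
        ≤ (ptraceRight τ y y).re * (Fintype.card b : ℝ) := by
      intro y
      refine mul_le_mul_of_nonneg_left ?_ (hp0 y)
      rw [trace_sub, trace_one, trace_smul, Complex.sub_re, smul_eq_mul, Complex.re_ofReal_mul]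
      have := mul_nonneg (hs0 y) (htrM y)
      simp
      linarith
    refine (Finset.sum_le_sum fun y _ => this y).trans ?_
    rw [← Finset.sum_mul, hpsum, one_mul]
  · intro _
    exact_mod_cast Fintype.card_pos



lemma ptr_psd {a b : Type*} [Fintype a] [Fintype b] (ρ : Matrix (a × b) (a × b) ℂ)
    (h : ρ.PosSemidef) : (ptraceRight ρ).PosSemidef := by
  have : ptraceRight ρ = ∑ c, ρ.submatrix (fun i => (i, c)) (fun i => (i, c)) := by
    ext i j; simp [ptraceRight, Matrix.sum_apply]
  rw [this]
  exact posSemidef_sum _ fun c _ => h.submatrix _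

lemma ptl_psd {a b : Type*} [Fintype a] [Fintype b] (ρ : Matrix (a × b) (a × b) ℂ)
    (h : ρ.PosSemidef) : (ptraceLeft ρ).PosSemidef := by
  have : ptraceLeft ρ = ∑ c, ρ.submatrix (fun i => (c, i)) (fun i => (c, i)) := by
    ext i j; simp [ptraceLeft, Matrix.sum_apply]
  rw [this]
  exact posSemidef_sum _ fun c _ => h.submatrix _

lemma ptr_trace {a b : Type*} [Fintype a] [Fintype b] (ρ : Matrix (a × b) (a × b) ℂ) :
    (ptraceRight ρ).trace = ρ.trace := by
  simp [trace, ptraceRight, Fintype.sum_prod_type]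

lemma core {P Y G a b : Type*} [Fintype P] [DecidableEq P] [Fintype Y] [DecidableEq Y]
    [Fintype G] [DecidableEq G] [Nonempty G] [Fintype a] [DecidableEq a] [Nonempty a] [Fintype b]
    [DecidableEq b] [Nonempty b] (p0 : P)
    (ω : Matrix (((P × Y) × G) × b) (((P × Y) × G) × b) ℂ) (hω : ω.PosSemidef)
    (hω1 : ω.trace = 1)
    (M : Y → Matrix b b ℂ) (hM : ∀ y, (M y).PosSemidef) (hM1 : ∀ y, (1 - M y).PosSemidef)
    (K : ℝ) (hK : ∑ y, (M y).trace.re = K) (hKpos : 0 < K)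
    (V : Matrix ((P × Y) × G) a ℂ) (hV : Vᴴ * V = 1)
    (σ : Matrix a a ℂ) (hσ : σ.PosSemidef) (hσ1 : σ.trace = 1)
    (hVσ : ∀ i, (V * σ * Vᴴ) i i = ∑ c, ω (i, c) (i, c))
    (τ : Matrix (Y × b) (Y × b) ℂ)
    (hτ : τ = ptraceRight (Matrix.reindex (pullYB P Y G b) (pullYB P Y G b) ω))
    (g x : ℝ) (hg : g = ∑ y, ∑ k, (ω.submatrix (Prod.mk ((p0, y), k)) (Prod.mk ((p0, y), k))
      * M y).trace.re) (hx : x = 1 - g) :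
    0 ≤ x ∧ x ≤ 1 ∧
    entropy σ ≤ Real.log (Fintype.card a) ∧
    entropy τ - entropy (ptraceRight τ) ≤ Real.log (Fintype.card b) ∧
    entropy σ + (entropy τ - entropy (ptraceRight τ)) ≤
      2 * (-(1 - x) * Real.log (1 - x) - x * Real.log x)
      + g * (Real.log (Fintype.card G) + Real.log K)
      + x * (Real.log (Fintype.card a) + Real.log (Fintype.card b)) ∧
    (K = 1 → entropy τ - entropy (ptraceRight τ) ≤ (-(1 - x) * Real.log (1 - x) - x * Real.log x)
      + x * Real.log (Fintype.card b)) ∧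
    (K = 1 → Fintype.card G = 1 → ∃ z : ℝ, g ≤ z ∧ x ≤ Fintype.card a - z ∧ z ≤ 1 ∧
      entropy σ ≤ g * (Real.log z - Real.log g)
        + x * (Real.log (Fintype.card a - z) - Real.log x)) := by
  set q : ((P × Y) × G) → ℝ := fun i => ((V * σ * Vᴴ) i i).re with hq
  set w : ((P × Y) × G) → ℝ := fun i => ((V * Vᴴ) i i).re with hw
  set m : ((P × Y) × G) → ℝ := fun i => (ω.submatrix (Prod.mk i) (Prod.mk i) * M i.1.2).trace.re
    with hm
  have hBlk : ∀ i, (ω.submatrix (Prod.mk i) (Prod.mk i)).PosSemidef := fun i => hω.submatrix _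
  have hqB : ∀ i, q i = (ω.submatrix (Prod.mk i) (Prod.mk i)).trace.re := by
    intro i
    simp only [hq, hVσ]
    rfl
  have hq0 : ∀ i, 0 ≤ q i := fun i => by rw [hqB]; exact tr_nonneg (hBlk i)
  have hm0 : ∀ i, 0 ≤ m i := fun i => tr_mul_nonneg (hBlk i) (hM _)
  have hmq : ∀ i, m i ≤ q i := fun i => by rw [hqB]; exact tr_mul_le (hBlk i) (hM1 _)
  have hmK : ∀ i, m i ≤ (M i.1.2).trace.re * q i := fun i => by
    rw [hqB]; exact tr_mul_le' (hBlk i) (hM _)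
  have hw0 : ∀ i, 0 ≤ w i := fun i => (proj_le V hV i).1
  have hw1 : ∀ i, w i ≤ 1 := fun i => (proj_le V hV i).2
  have hqsum : ∑ i, q i = 1 := by
    have : ∑ i, q i = (V * σ * Vᴴ).trace.re := by rw [trace, Complex.re_sum]; rfl
    rw [this, Matrix.mul_assoc, trace_mul_comm, Matrix.mul_assoc, hV, Matrix.mul_one, hσ1]; simp
  have hwsum : ∑ i, w i = Fintype.card a := by
    have : ∑ i, w i = (V * Vᴴ).trace.re := by rw [trace, Complex.re_sum]; rfl
    rw [this, trace_mul_comm, hV, trace_one]; simp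
  have hqw : ∀ i, q i ≤ w i := by
    intro i
    have h1 : (1 - σ).PosSemidef := by
      have := tr_sub_psd hσ
      rw [hσ1] at this
      simpa using this
    have h2 := (Complex.le_def.1 ((h1.mul_mul_conjTranspose_same V).diag_nonneg (i := i))).1
    rw [Matrix.mul_sub, Matrix.sub_mul, Matrix.mul_one] at h2
    simp only [Matrix.sub_apply, Complex.sub_re, Complex.zero_re] at h2
    simp only [hq, hw]
    linarith
  have htrM : ∀ y, 0 ≤ (M y).trace.re := fun y => tr_nonneg (hM y)
  set γ : Y → ℝ := fun y => ∑ k, m ((p0, y), k) with hγ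
  set al : Y → ℝ := fun y => ∑ k, q ((p0, y), k) with hal
  set be : Y → ℝ := fun y => ∑ p, ∑ k, m ((p, y), k) with hbe
  set py : Y → ℝ := fun y => ∑ p, ∑ k, q ((p, y), k) with hpy
  have hgγ : g = ∑ y, γ y := hg
  have hγ0 : ∀ y, 0 ≤ γ y := fun y => Finset.sum_nonneg fun k _ => hm0 _
  have hal0 : ∀ y, 0 ≤ al y := fun y => Finset.sum_nonneg fun k _ => hq0 _
  have hbe0 : ∀ y, 0 ≤ be y := fun y => Finset.sum_nonneg fun p _ => Finset.sum_nonneg fun k _ => hm0 _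
  have hγal : ∀ y, γ y ≤ al y := fun y => Finset.sum_le_sum fun k _ => hmq _
  have hγbe : ∀ y, γ y ≤ be y := fun y =>
    Finset.single_le_sum (f := fun p => ∑ k, m ((p, y), k))
      (fun p _ => Finset.sum_nonneg fun k _ => hm0 _) (Finset.mem_univ p0)
  have halpy : ∀ y, al y ≤ py y := fun y =>
    Finset.single_le_sum (f := fun p => ∑ k, q ((p, y), k))
      (fun p _ => Finset.sum_nonneg fun k _ => hq0 _) (Finset.mem_univ p0)
  have hpysum : ∑ y, py y = 1 := by
    rw [← hqsum, Fintype.sum_prod_type, Fintype.sum_prod_type_right]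
  have hg0 : 0 ≤ g := by rw [hgγ]; exact Finset.sum_nonneg fun y _ => hγ0 y
  have hg1 : g ≤ 1 := by
    rw [hgγ, ← hpysum]; exact Finset.sum_le_sum fun y _ => (hγal y).trans (halpy y)
  have hγK : ∀ y, γ y ≤ (M y).trace.re * al y := fun y => by
    rw [hal, Finset.mul_sum]; exact Finset.sum_le_sum fun k _ => hmK ((p0, y), k)
  have hx0 : 0 ≤ x := by linarith
  have hx1 : x ≤ 1 := by linarith
  have hcard : (0:ℝ) < Fintype.card a := by exact_mod_cast Fintype.card_pos
  have hcardb : (0:ℝ) < Fintype.card b := by exact_mod_cast Fintype.card_pos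
  have hcardG : (0:ℝ) < Fintype.card G := by exact_mod_cast Fintype.card_pos
  -- facts about τ
  have hτpsd : τ.PosSemidef := by
    rw [hτ]; exact ptr_psd _ (hω.submatrix _)
  have hτY : (ptraceRight τ).PosSemidef := ptr_psd _ hτpsd
  have hτ1 : τ.trace = 1 := by
    rw [hτ, ptr_trace, ← hω1]
    exact Equiv.sum_comp (pullYB P Y G b).symm (fun i => ω i i)
  have hτsub : ∀ y, τ.submatrix (Prod.mk y) (Prod.mk y)
      = ∑ p, ∑ k, ω.submatrix (Prod.mk ((p, y), k)) (Prod.mk ((p, y), k)) := by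
    intro y
    ext c c'
    rw [hτ]
    simp only [Matrix.sum_apply, submatrix_apply, ptraceRight, Fintype.sum_prod_type]
    rfl
  have hτp : ∀ y, (ptraceRight τ y y).re = py y := by
    intro y
    have : (ptraceRight τ y y).re = (τ.submatrix (Prod.mk y) (Prod.mk y)).trace.re := rfl
    rw [this, hτsub, trace_sum, Complex.re_sum]
    simp only [trace_sum, Complex.re_sum, hpy, hqB]
  have hτb : ∀ y, (τ.submatrix (Prod.mk y) (Prod.mk y) * M y).trace.re = be y := by
    intro y
    rw [hτsub, Finset.sum_mul, trace_sum, Complex.re_sum]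
    simp only [Finset.sum_mul, trace_sum, Complex.re_sum, hbe, hm]
  have hdiv : ∀ u v : ℝ, 0 ≤ u → u ≤ v → u / v * v = u := by
    intro u v hu huv
    by_cases h : v = 0
    · have : u = 0 := by linarith
      simp [this]
    · exact div_mul_cancel₀ _ h
  -- Bob bound
  have hBob := bob τ hτpsd hτY hτ1 M hM hM1 (fun y => γ y / be y)
    (fun y => div_nonneg (hγ0 y) (hbe0 y)) (fun y => div_le_one_of_le₀ (hγbe y) (hbe0 y)) γ
    (by intro y; rw [hτb]; exact hdiv _ _ (hγ0 y) (hγbe y)) x (by rw [← hgγ, hx])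
  have hBob2 : entropy τ - entropy (ptraceRight τ) ≤
      ∑ y, γ y * (Real.log (py y) - Real.log (γ y)) + ∑ y, γ y * Real.log (M y).trace.re
      + x * (Real.log (Fintype.card b) - Real.log x) := by
    refine hBob.trans (le_of_eq ?_)
    rw [← Finset.sum_add_distrib]
    congr 1
    refine Finset.sum_congr rfl fun y _ => ?_
    by_cases h : γ y = 0
    · simp [h]
    have h1 : 0 < γ y := lt_of_le_of_ne (hγ0 y) (Ne.symm h)
    have h2 : 0 < py y := h1.trans_le ((hγal y).trans (halpy y))
    have h3 : 0 < (M y).trace.re := by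
      rcases (htrM y).eq_or_lt with h4 | h4
      · have := hγK y
        rw [← h4] at this
        linarith
      · exact h4
    rw [hτp, Real.log_mul h2.ne' h3.ne']
    ring
  have hgib1 : ∑ y, γ y * (Real.log (py y) - Real.log (γ y)) ≤ g * (Real.log 1 - Real.log g) :=
    gibbs_sum γ py 1 g hγ0 (fun y => (hal0 y).trans (halpy y))
      (fun y => by
        intro h
        have h1 : 0 < γ y := lt_of_le_of_ne (hγ0 y) (Ne.symm h)
        exact h1.trans_le ((hγal y).trans (halpy y)))
      hgγ.symm hpysum.le one_pos
  have hgib2 : ∑ y, γ y * (Real.log (M y).trace.re - Real.log (γ y)) ≤ g * (Real.log K - Real.log g) :=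
    gibbs_sum γ (fun y => (M y).trace.re) K g hγ0 htrM
      (fun y => by
        intro h
        have h1 : 0 < γ y := lt_of_le_of_ne (hγ0 y) (Ne.symm h)
        rcases (htrM y).eq_or_lt with h4 | h4
        · have := hγK y
          rw [← h4] at this
          linarith
        · exact h4)
      hgγ.symm hK.le hKpos
  have hgx : 1 - x = g := by linarith
  refine ⟨hx0, hx1, ?_, ?_, ?_, ?_, ?_⟩
  · have := alice σ hσ hσ1 V hV (κ := Empty) (fun _ _ => 0) (by simp) (by simp) (fun _ => 0)
      (fun _ => 0) (by simp) (by simp) (by simp) 1 (Fintype.card a) (by simp) (by simp)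
      (fun _ => hcard)
    simpa using this
  · have := bob τ hτpsd hτY hτ1 M hM hM1 (fun y => 0) (by simp) (by simp) (fun y => 0)
      (by simp) 1 (by simp)
    simpa using this
  · have hA := alice σ hσ hσ1 V hV (κ := Y)
      (fun y i => if i.1.1 = p0 ∧ i.1.2 = y then γ y / al y else 0)
      (by
        intro y i
        split_ifs
        · exact div_nonneg (hγ0 y) (hal0 y)
        · exact le_rfl)
      (by
        intro i
        by_cases hi : i.1.1 = p0
        · simp only [hi, true_and, Finset.sum_ite_eq, Finset.mem_univ, if_true]
          exact div_le_one_of_le₀ (hγal _) (hal0 _)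
        · simp [hi])
      (fun _ => (Fintype.card G : ℝ)) γ
      (by
        intro y
        simp only [ite_mul, zero_mul, Fintype.sum_prod_type]
        rw [Finset.sum_eq_single p0, Finset.sum_eq_single y]
        · simp only [and_self, if_true]
          rw [← Finset.mul_sum]
          exact hdiv _ _ (hγ0 y) (hγal y)
        · intro y' _ hy'; simp [hy']
        · simp
        · intro p _ hp; simp [hp]
        · simp)
      (by
        intro y
        simp only [ite_mul, zero_mul, Fintype.sum_prod_type]
        rw [Finset.sum_eq_single p0, Finset.sum_eq_single y]
        · simp only [and_self, if_true]
          calc ∑ k, γ y / al y * w ((p0, y), k) ≤ ∑ k : G, 1 := by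
                refine Finset.sum_le_sum fun k _ => ?_
                have h1 : γ y / al y ≤ 1 := div_le_one_of_le₀ (hγal _) (hal0 _)
                have h2 := mul_le_mul h1 (hw1 ((p0, y), k)) (hw0 _) zero_le_one
                linarith
            _ = Fintype.card G := by simp
        · intro y' _ hy'; simp [hy']
        · simp
        · intro p _ hp; simp [hp]
        · simp)
      (fun _ _ => hcardG) x (Fintype.card a) (by rw [← hgγ, hx])
      (by
        have : 0 ≤ ∑ y, ∑ i : (P × Y) × G, (if i.1.1 = p0 ∧ i.1.2 = y then γ y / al y else 0) *
            ((V * Vᴴ) i i).re := by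
          refine Finset.sum_nonneg fun y _ => Finset.sum_nonneg fun i _ => mul_nonneg ?_ (hw0 i)
          split_ifs
          · exact div_nonneg (hγ0 y) (hal0 y)
          · exact le_rfl
        linarith)
      (fun _ => hcard)
    simp only [mul_sub, Finset.sum_sub_distrib, ← Finset.sum_mul, ← hgγ] at hA hBob2 hgib1 hgib2
    rw [hgx]
    rw [Real.log_one] at hgib1
    linarith
  · intro hK1
    have : ∑ y, γ y * Real.log (M y).trace.re ≤ 0 := by
      refine Finset.sum_nonpos fun y _ => mul_nonpos_of_nonneg_of_nonpos (hγ0 y) ?_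
      refine Real.log_nonpos (htrM y) ?_
      rw [← hK1, ← hK]
      exact Finset.single_le_sum (f := fun y => (M y).trace.re) (fun y _ => htrM y) (Finset.mem_univ y)
    rw [hgx]
    rw [Real.log_one] at hgib1
    linarith
  · intro hK1 hG1
    set D : ℝ := ∑ y, (M y).trace.re * al y with hD
    have hgD : g ≤ D := by rw [hgγ]; exact Finset.sum_le_sum fun y _ => hγK y
    have hMle : ∀ y, (M y).trace.re ≤ 1 := fun y => by
      rw [← hK1, ← hK]
      exact Finset.single_le_sum (f := fun y => (M y).trace.re) (fun y _ => htrM y) (Finset.mem_univ y)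
    have hs0 : 0 ≤ g / D := div_nonneg hg0 (hg0.trans hgD)
    have hs1 : g / D ≤ 1 := div_le_one_of_le₀ hgD (hg0.trans hgD)
    set d : ((P × Y) × G) → ℝ := fun i => if i.1.1 = p0 then g / D * (M i.1.2).trace.re else 0 with hd
    have hd0 : ∀ i, 0 ≤ d i := by
      intro i
      simp only [hd]
      split_ifs
      · exact mul_nonneg hs0 (htrM _)
      · exact le_rfl
    have hd1 : ∀ i, d i ≤ 1 := by
      intro i
      simp only [hd]
      split_ifs
      · have := mul_le_mul hs1 (hMle i.1.2) (htrM _) zero_le_one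
        linarith
      · exact zero_le_one
    have hdq : ∑ i, d i * q i = g := by
      have : ∑ i, d i * q i = g / D * D := by
        simp only [hd, Fintype.sum_prod_type, ite_mul, zero_mul]
        rw [Finset.sum_eq_single p0]
        · simp only [if_true, hD, hal, Finset.mul_sum, mul_assoc]
        · intro p _ hp; simp [hp]
        · simp
      rw [this]
      exact hdiv _ _ hg0 hgD
    have hdw : ∑ i, d i * w i ≤ 1 := by
      have : ∑ i, d i * w i ≤ ∑ i, d i :=
        Finset.sum_le_sum fun i _ => mul_le_of_le_one_right (hd0 i) (hw1 i)
      refine this.trans ?_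
      simp only [hd, Fintype.sum_prod_type]
      rw [Finset.sum_eq_single p0]
      · simp only [if_true, Finset.sum_const, Finset.card_univ, hG1, one_smul]
        rw [← Finset.mul_sum, hK, hK1, mul_one]
        exact hs1
      · intro p _ hp; simp [hp]
      · simp
    have hz1 : g ≤ ∑ i, d i * w i := by
      rw [← hdq]
      exact Finset.sum_le_sum fun i _ => mul_le_mul_of_nonneg_left (hqw i) (hd0 i)
    have hz2 : x ≤ Fintype.card a - ∑ i, d i * w i := by
      have h1 : ∑ i, (1 - d i) * q i ≤ ∑ i, (1 - d i) * w i :=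
        Finset.sum_le_sum fun i _ => mul_le_mul_of_nonneg_left (hqw i) (sub_nonneg.2 (hd1 i))
      simp only [sub_mul, one_mul, Finset.sum_sub_distrib, hqsum, hwsum, hdq] at h1
      linarith
    refine ⟨∑ i, d i * w i, hz1, hz2, hdw, ?_⟩
    have := alice σ hσ hσ1 V hV (κ := Unit) (fun _ => d) (fun _ => hd0) (by simpa using hd1)
      (fun _ => ∑ i, d i * w i) (fun _ => g) (fun _ => hdq) (fun _ => le_rfl)
      (fun _ h => (lt_of_le_of_ne hg0 (Ne.symm h)).trans_le hz1) x
      (Fintype.card a - ∑ i, d i * w i) (by simp [hx]) (by simp [hw])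
      (fun h => (lt_of_le_of_ne hx0 (Ne.symm h)).trans_le hz2)
    simpa using this



lemma bin_le_log_two (x : ℝ) (hx0 : 0 ≤ x) (hx1 : x ≤ 1) :
    -(1 - x) * Real.log (1 - x) - x * Real.log x ≤ Real.log 2 := by
  have h := gibbs_sum (J := Bool) (fun b => if b then 1 - x else x)
    (fun b => 1) 2 1 (by intro b; cases b <;> simp <;> linarith)
    (by intro b; cases b <;> norm_num) (by intro b; cases b <;> norm_num) (by simp)
    (by norm_num) (by norm_num)
  simp at h
  linarith

lemma final_real (S T x g ε : ℝ) (NA NB G K : ℕ) (hNA : 1 ≤ NA) (hNB : 1 ≤ NB) (hG : 1 ≤ G)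
    (hK : 1 ≤ K) (hx0 : 0 ≤ x) (hx1 : x ≤ 1) (hg : x = 1 - g) (hε : 2 * x ≤ ε)
    (h1 : S ≤ Real.log NA) (h2 : T ≤ Real.log NB)
    (h3 : S + T ≤ 2 * (-(1 - x) * Real.log (1 - x) - x * Real.log x)
      + g * (Real.log G + Real.log K) + x * (Real.log NA + Real.log NB))
    (h4 : (K : ℝ) = 1 → T ≤ (-(1 - x) * Real.log (1 - x) - x * Real.log x) + x * Real.log NB)
    (h5 : (K : ℝ) = 1 → G = 1 → ∃ z : ℝ, g ≤ z ∧ x ≤ NA - z ∧ z ≤ 1 ∧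
      S ≤ g * (Real.log z - Real.log g) + x * (Real.log (NA - z) - Real.log x)) :
    S + T ≤ Real.log G + Real.log K + 2 / Real.exp 1 + ε * (Real.log NA + Real.log NB) := by
  have rNA : (1:ℝ) ≤ NA := by exact_mod_cast hNA
  have rNB : (1:ℝ) ≤ NB := by exact_mod_cast hNB
  have rG : (1:ℝ) ≤ G := by exact_mod_cast hG
  have rK : (1:ℝ) ≤ K := by exact_mod_cast hK
  have lNA := Real.log_nonneg rNA
  have lNB := Real.log_nonneg rNB
  have lG := Real.log_nonneg rG
  have lK := Real.log_nonneg rK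
  have he : 0 ≤ 2 / Real.exp 1 := by positivity
  have hεL : 2 * x * (Real.log NA + Real.log NB) ≤ ε * (Real.log NA + Real.log NB) :=
    mul_le_mul_of_nonneg_right hε (by linarith)
  have hxL : 0 ≤ x * (Real.log NA + Real.log NB) := mul_nonneg hx0 (by linarith)
  have l2 := log_two_le
  have hbin := bin_le_log_two x hx0 hx1
  by_cases hx2 : 1 / 2 ≤ x
  · have : 1 * (Real.log NA + Real.log NB) ≤ ε * (Real.log NA + Real.log NB) :=
      mul_le_mul_of_nonneg_right (by linarith) (by linarith)
    linarith
  push Not at hx2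
  by_cases c1 : NA * NB ≤ 2 * (G * K)
  · have : Real.log ((NA : ℝ) * NB) ≤ Real.log (2 * (G * K)) :=
      Real.log_le_log (by positivity) (by exact_mod_cast c1)
    rw [Real.log_mul (by positivity) (by positivity), Real.log_mul (by norm_num) (by positivity),
      Real.log_mul (by positivity) (by positivity)] at this
    linarith
  by_cases c2 : 6 ≤ G * K * (NA * NB)
  · have : Real.log 6 ≤ Real.log ((G * K : ℝ) * (NA * NB)) :=
      Real.log_le_log (by norm_num) (by exact_mod_cast c2)
    rw [Real.log_mul (by positivity) (by positivity), Real.log_mul (by positivity) (by positivity),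
      Real.log_mul (by positivity) (by positivity)] at this
    have h6 := two_bin_le x hx0 hx1
    have h7 := mul_le_mul_of_nonneg_left this hx0
    have h8 : g = 1 - x := by linarith
    rw [h8] at h3
    linarith
  push Not at c1 c2
  have hGK : G * K = 1 := by
    have : 1 ≤ G * K := Nat.mul_pos hG hK
    by_contra h
    have := Nat.mul_le_mul (show 2 ≤ G * K by omega) (show 4 ≤ NA * NB by omega)
    omega
  have hG1 : G = 1 := Nat.dvd_one.1 ⟨K, hGK.symm⟩
  have hK1 : K = 1 := Nat.dvd_one.1 ⟨G, by rw [mul_comm]; exact hGK.symm⟩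
  have hK1' : (K : ℝ) = 1 := by exact_mod_cast hK1
  have hT := h4 hK1'
  obtain ⟨z, z1, z2, z3, hS⟩ := h5 hK1' hG1
  subst hG1 hK1
  simp only [one_mul] at c1 c2
  have hgx : g = 1 - x := by linarith
  have hgpos : 0 < g := by linarith
  simp only [Nat.cast_one, Real.log_one]
  by_cases n1 : NA = 1
  · subst n1
    simp only [Nat.cast_one, Real.log_one] at *
    nlinarith
  by_cases n2 : NB = 1
  · subst n2
    simp only [Nat.cast_one, Real.log_one] at *
    have e1 : Real.log z ≤ 0 := Real.log_nonpos (hgpos.le.trans z1) z3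
    have e2 : x * Real.log (NA - z) ≤ x * Real.log NA := by
      rcases hx0.eq_or_lt with h | h
      · simp [← h]
      · exact mul_le_mul_of_nonneg_left (Real.log_le_log (by linarith) (by linarith)) hx0
    have e3 := mul_nonpos_of_nonneg_of_nonpos hgpos.le e1
    rw [hgx] at hS e3
    linarith
  have m1 : 2 ≤ NA := by omega
  have m2 : 2 ≤ NB := by omega
  have a1 : NA = 2 := by
    by_contra h
    have := Nat.mul_le_mul (show 3 ≤ NA by omega) m2
    omega
  have a2 : NB = 2 := by
    by_contra h
    have := Nat.mul_le_mul m1 (show 3 ≤ NB by omega)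
    omega
  subst a1 a2
  have k1 : g * Real.log z + x * Real.log ((2:ℝ) - z) ≤ 0 := by
    have i1 : Real.log z ≤ z - 1 := Real.log_le_sub_one_of_pos (by linarith)
    have i2 : Real.log (2 - z) ≤ (2 - z) - 1 := Real.log_le_sub_one_of_pos (by linarith)
    have i3 := mul_le_mul_of_nonneg_left i1 hgpos.le
    have i4 := mul_le_mul_of_nonneg_left i2 hx0
    have i5 : 0 ≤ (g - x) * (1 - z) := mul_nonneg (by linarith) (by linarith)
    nlinarith
  have k2 := two_bin_le x hx0 hx1
  have k3 : Real.log 6 ≤ 3 * Real.log 2 := by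
    have : (3:ℝ) * Real.log 2 = Real.log (2^3) := by rw [Real.log_pow]; norm_num
    rw [this]
    exact Real.log_le_log (by norm_num) (by norm_num)
  have k4 := mul_le_mul_of_nonneg_left k3 hx0
  rw [hgx] at hS k1
  push_cast at *
  linarith



lemma sum_fun_prod {R ι : Type*} [CommSemiring R] [Fintype ι] {n : ℕ} (f : Fin n → ι → R) :
    ∑ x : Fin n → ι, ∏ k, f k (x k) = ∏ k, ∑ i, f k i := by
  classical
  rw [Finset.prod_univ_sum, Fintype.piFinset_univ]

lemma tpow_mul {ι : Type*} [Fintype ι] (A B : Matrix ι ι ℂ) (n : ℕ) :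
    tpow (A * B) n = tpow A n * tpow B n := by
  ext x y
  simp only [tpow, mul_apply, ← Finset.prod_mul_distrib]
  rw [sum_fun_prod (fun k i => A (x k) i * B i (y k))]

lemma tpow_conj {ι : Type*} (A : Matrix ι ι ℂ) (n : ℕ) :
    tpow (Aᴴ) n = (tpow A n)ᴴ := by
  ext x y
  simp [tpow, conjTranspose_apply]

lemma tpow_diagonal {ι : Type*} [DecidableEq ι] (d : ι → ℂ) (n : ℕ) :
    tpow (diagonal d) n = diagonal (fun x => ∏ k, d (x k)) := by
  ext x y
  by_cases h : x = y
  · subst h; simp [tpow]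
  · rw [diagonal_apply_ne _ h]
    obtain ⟨k, hk⟩ := Function.ne_iff.1 h
    exact Finset.prod_eq_zero (Finset.mem_univ k) (diagonal_apply_ne _ hk)

lemma tpow_one {ι : Type*} [DecidableEq ι] (n : ℕ) :
    tpow (1 : Matrix ι ι ℂ) n = 1 := by
  rw [← diagonal_one, tpow_diagonal]; simp

lemma tpow_spec {ι : Type*} [Fintype ι] [DecidableEq ι] (ρ : Matrix ι ι ℂ) (hρ : ρ.PosSemidef)
    (h1 : ρ.trace = 1) (n : ℕ) :
    (tpow ρ n).PosSemidef ∧ (tpow ρ n).trace = 1 ∧ entropy (tpow ρ n) = n * entropy ρ := by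
  have htr : (tpow ρ n).trace = 1 := by
    have : (tpow ρ n).trace = ∏ k : Fin n, ρ.trace := by
      simp only [trace, tpow, diag_apply]
      rw [sum_fun_prod (fun _ i => ρ i i)]
    rw [this, h1]; simp
  obtain ⟨U, l, hU1, hU2, hl, hρU, hent⟩ := spec hρ
  have hW1 : (tpow U n)ᴴ * tpow U n = 1 := by rw [← tpow_conj, ← tpow_mul, hU1, tpow_one]
  have hd : tpow ρ n = tpow U n * diagonal (fun x => ((∏ k, l (x k) : ℝ) : ℂ)) * (tpow U n)ᴴ := by
    rw [hρU, tpow_mul, tpow_mul, tpow_diagonal, tpow_conj]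
    simp
  have hls : ∑ i, l i = 1 := by
    have h2 : ρ.trace.re = ∑ i, l i := by
      rw [hρU, trace_mul_comm, ← mul_assoc, hU1, one_mul, trace_diagonal, Complex.re_sum]
      simp
    rw [← h2, h1]; simp
  refine ⟨?_, htr, ?_⟩
  · rw [hd]
    exact (diag_psd _ (fun x => Finset.prod_nonneg fun k _ => hl _)).mul_mul_conjTranspose_same _
  · rw [entropy_eq_of_diag _ _ _ hW1 hd, hent]
    have e1 : ∀ x : Fin n → ι, (∏ k, l (x k)) * Real.log (∏ k, l (x k))
        = ∑ j, ∏ k, (if k = j then l (x k) * Real.log (l (x k)) else l (x k)) := by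
      intro x
      by_cases h : ∀ k, l (x k) ≠ 0
      · rw [Real.log_prod (fun k _ => h k), Finset.mul_sum]
        refine Finset.sum_congr rfl fun j _ => ?_
        rw [← Finset.mul_prod_erase _ _ (Finset.mem_univ j),
          ← Finset.mul_prod_erase _ _ (Finset.mem_univ j)]
        rw [if_pos rfl]
        have : ∏ k ∈ univ.erase j, (if k = j then l (x k) * Real.log (l (x k)) else l (x k))
            = ∏ k ∈ univ.erase j, l (x k) :=
          Finset.prod_congr rfl fun k hk => if_neg (Finset.ne_of_mem_erase hk)
        rw [this]; ring
      · push Not at h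
        obtain ⟨k, hk⟩ := h
        rw [Finset.prod_eq_zero (Finset.mem_univ k) hk, zero_mul]
        symm
        refine Finset.sum_eq_zero fun j _ => ?_
        refine Finset.prod_eq_zero (Finset.mem_univ k) ?_
        simp [hk]
    simp only [e1]
    rw [Finset.sum_comm]
    have e2 : ∀ j : Fin n, ∑ x : Fin n → ι,
        ∏ k, (if k = j then l (x k) * Real.log (l (x k)) else l (x k)) = ∑ i, l i * Real.log (l i) := by
      intro j
      rw [sum_fun_prod (fun k i => if k = j then l i * Real.log (l i) else l i)]
      rw [Finset.prod_eq_single j]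
      · simp
      · intro k _ hk; simp [hk, hls]
      · simp
    simp only [e2]
    simp

lemma tpowAB_apply {α β : Type*} (ρ : Matrix (α × β) (α × β) ℂ) (n : ℕ) (x x' : Fin n → α)
    (y y' : Fin n → β) : tpowAB ρ n (x, y) (x', y') = ∏ k, ρ (x k, y k) (x' k, y' k) := rfl

lemma ptr_tpowAB {α β : Type*} [Fintype β] (ρ : Matrix (α × β) (α × β) ℂ) (n : ℕ) :
    ptraceRight (tpowAB ρ n) = tpow (ptraceRight ρ) n := by
  ext x x'
  simp only [ptraceRight, tpowAB_apply, tpow]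
  rw [sum_fun_prod (fun k i => ρ (x k, i) (x' k, i))]

lemma ptl_tpowAB {α β : Type*} [Fintype α] (ρ : Matrix (α × β) (α × β) ℂ) (n : ℕ) :
    ptraceLeft (tpowAB ρ n) = tpow (ptraceLeft ρ) n := by
  ext x x'
  simp only [ptraceLeft, tpowAB_apply, tpow]
  rw [sum_fun_prod (fun k i => ρ (i, x k) (i, x' k))]

lemma ptl_trace {a b : Type*} [Fintype a] [Fintype b] (ρ : Matrix (a × b) (a × b) ℂ) :
    (ptraceLeft ρ).trace = ρ.trace := by
  simp [trace, ptraceLeft, Fintype.sum_prod_type_right]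

lemma tpowAB_psd {α β : Type*} [Fintype α] [DecidableEq α] [Fintype β] [DecidableEq β]
    (ρ : Matrix (α × β) (α × β) ℂ) (hρ : ρ.PosSemidef) (h1 : ρ.trace = 1) (n : ℕ) :
    (tpowAB ρ n).PosSemidef ∧ (tpowAB ρ n).trace = 1 := by
  obtain ⟨e1, e2, -⟩ := tpow_spec ρ hρ h1 n
  refine ⟨e1.submatrix _, ?_⟩
  rw [← e2]
  exact Equiv.sum_comp (Equiv.arrowProdEquivProdArrow (Fin n) (fun _ => α) (fun _ => β)).symm
    (fun i => tpow ρ n i i)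



/-- Alice's isometry `x ↦ U_A (x ⊗ |0⟩)`. -/
def isoV {n : ℕ} (Pr : Protocol α β n) :
    Matrix ((Fin Pr.dAp × Fin Pr.dY) × Fin Pr.dAg) (Fin n → α) ℂ :=
  fun i x => Pr.UA i (x, ⟨0, Pr.dC_pos⟩)

/-- Bob's effect for the message `y`. -/
def effM {n : ℕ} (Pr : Protocol α β n) (q : Fin Pr.dBp) (y : Fin Pr.dY) :
    Matrix (Fin n → β) (Fin n → β) ℂ :=
  (Matrix.of fun (k : Fin Pr.dBg) (c : Fin n → β) => Pr.UB (q, k) (c, y))ᴴ *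
    (Matrix.of fun (k : Fin Pr.dBg) (c : Fin n → β) => Pr.UB (q, k) (c, y))

lemma effM_psd {n : ℕ} (Pr : Protocol α β n) (q : Fin Pr.dBp) (y : Fin Pr.dY) :
    (effM Pr q y).PosSemidef := posSemidef_conjTranspose_mul_self _

lemma effM_sum {n : ℕ} (Pr : Protocol α β n) (y : Fin Pr.dY) :
    ∑ q, effM Pr q y = 1 := by
  ext c c'
  have h := congrFun (congrFun Pr.UB_unitary.1 (c, y)) (c', y)
  rw [mul_apply, Fintype.sum_prod_type] at h
  simp only [Matrix.sum_apply, effM, mul_apply, conjTranspose_apply, of_apply]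
  simp only [conjTranspose_apply] at h
  rw [h]
  by_cases hc : c = c'
  · subst hc; simp
  · simp [hc]

lemma effM_one_sub {n : ℕ} (Pr : Protocol α β n) (q : Fin Pr.dBp) (y : Fin Pr.dY) :
    (1 - effM Pr q y).PosSemidef := by
  rw [← effM_sum Pr y, ← Finset.add_sum_erase _ _ (Finset.mem_univ q), add_sub_cancel_left]
  exact posSemidef_sum _ fun q _ => effM_psd Pr q y

lemma effM_trace {n : ℕ} (Pr : Protocol α β n) (q : Fin Pr.dBp) :
    ∑ y, (effM Pr q y).trace.re = Pr.dBg := by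
  have h : ∀ k, ∑ c, ∑ y, Pr.UB (q, k) (c, y) * star (Pr.UB (q, k) (c, y)) = 1 := by
    intro k
    have h := congrFun (congrFun Pr.UB_unitary.2 (q, k)) (q, k)
    rw [mul_apply, Fintype.sum_prod_type, one_apply_eq] at h
    exact h
  have h2 : ∑ y, (effM Pr q y).trace = ∑ k : Fin Pr.dBg, 1 := by
    have hR : ∑ k : Fin Pr.dBg, (1:ℂ) = ∑ k, ∑ c, ∑ y, Pr.UB (q, k) (c, y) * star (Pr.UB (q, k) (c, y)) :=
      Finset.sum_congr rfl fun k _ => (h k).symm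
    rw [hR]
    simp only [trace, diag_apply, effM, mul_apply, conjTranspose_apply, of_apply]
    rw [Finset.sum_comm]
    conv_rhs => rw [Finset.sum_comm]
    refine Finset.sum_congr rfl fun c _ => ?_
    rw [Finset.sum_comm]
    refine Finset.sum_congr rfl fun k _ => Finset.sum_congr rfl fun y _ => ?_
    rw [mul_comm]
  rw [← Complex.re_sum, h2]
  simp

lemma isoV_iso {n : ℕ} (Pr : Protocol α β n) : (isoV Pr)ᴴ * isoV Pr = 1 := by
  ext x x'
  have h := congrFun (congrFun Pr.UA_unitary.1 (x, ⟨0, Pr.dC_pos⟩)) (x', ⟨0, Pr.dC_pos⟩)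
  rw [mul_apply] at h ⊢
  simp only [conjTranspose_apply, isoV] at h ⊢
  rw [h]
  by_cases hc : x = x'
  · subst hc; simp
  · simp [hc]

lemma omega_eq (ρ : Matrix (α × β) (α × β) ℂ) {n : ℕ} (Pr : Protocol α β n) :
    stateAfterUA ρ Pr = (isoV Pr ⊗ₖ (1 : Matrix (Fin n → β) (Fin n → β) ℂ)) * tpowAB ρ n *
      (isoV Pr ⊗ₖ (1 : Matrix (Fin n → β) (Fin n → β) ℂ))ᴴ := by
  set J : Matrix (((Fin n → α) × Fin Pr.dC) × (Fin n → β)) ((Fin n → α) × (Fin n → β)) ℂ :=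
    fun u v => if u.1.1 = v.1 ∧ u.1.2.val = 0 ∧ u.2 = v.2 then 1 else 0 with hJ
  have h1 : inputState ρ Pr = J * tpowAB ρ n * Jᴴ := by
    ext ⟨⟨x, c⟩, d⟩ ⟨⟨x', c'⟩, d'⟩
    have e : inputState ρ Pr ((x, c), d) ((x', c'), d')
        = tpowAB ρ n (x, d) (x', d') * (if c.val = 0 ∧ c'.val = 0 then 1 else 0) := rfl
    rw [e, mul_apply, Finset.sum_eq_single (x', d')]
    · rw [mul_apply, Finset.sum_eq_single (x, d)]
      · rw [conjTranspose_apply]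
        by_cases hc : c.val = 0 <;> by_cases hc' : c'.val = 0 <;>
          simp [hJ, hc, hc']
      · rintro ⟨u, v⟩ _ hu
        have : ¬ (x = u ∧ c.val = 0 ∧ d = v) := by
          rintro ⟨rfl, -, rfl⟩; exact hu rfl
        simp only [hJ, if_neg this, zero_mul]
      · simp
    · rintro ⟨u, v⟩ _ hu
      have : ¬ (x' = u ∧ c'.val = 0 ∧ d' = v) := by
        rintro ⟨rfl, -, rfl⟩; exact hu rfl
      rw [conjTranspose_apply]
      simp only [hJ, if_neg this, star_zero, mul_zero]
    · simp
  have h2 : (Pr.UA ⊗ₖ (1 : Matrix (Fin n → β) (Fin n → β) ℂ)) * J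
      = isoV Pr ⊗ₖ (1 : Matrix (Fin n → β) (Fin n → β) ℂ) := by
    ext ⟨i, d⟩ ⟨x, d'⟩
    rw [mul_apply, Finset.sum_eq_single ((x, ⟨0, Pr.dC_pos⟩), d')]
    · simp [hJ, isoV, kroneckerMap_apply]
    · rintro ⟨⟨u, c⟩, v⟩ _ hu
      have : ¬ (u = x ∧ c.val = 0 ∧ v = d') := by
        rintro ⟨rfl, hc, rfl⟩
        apply hu
        have : c = ⟨0, Pr.dC_pos⟩ := Fin.ext hc
        rw [this]
      simp only [hJ, if_neg this, mul_zero]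
    · simp
  rw [← h2, stateAfterUA, h1, conjTranspose_mul]
  simp only [Matrix.mul_assoc]

lemma omega_apply (ρ : Matrix (α × β) (α × β) ℂ) {n : ℕ} (Pr : Protocol α β n)
    (i i' : (Fin Pr.dAp × Fin Pr.dY) × Fin Pr.dAg) (c c' : Fin n → β) :
    stateAfterUA ρ Pr (i, c) (i', c') =
      ∑ x', ∑ x, isoV Pr i x * tpowAB ρ n (x, c) (x', c') * star (isoV Pr i' x') := by
  rw [omega_eq]
  have : (isoV Pr ⊗ₖ (1 : Matrix (Fin n → β) (Fin n → β) ℂ))ᴴ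
      = (isoV Pr)ᴴ ⊗ₖ (1 : Matrix (Fin n → β) (Fin n → β) ℂ) := by
    rw [conjTranspose_kronecker, conjTranspose_one]
  rw [this]
  simp only [mul_apply, Fintype.sum_prod_type, kroneckerMap_apply, one_apply,
        mul_ite, mul_one, mul_zero, ite_mul, zero_mul, Finset.sum_ite_eq, Finset.sum_ite_eq',
        Finset.mem_univ, if_true, Finset.sum_mul, conjTranspose_apply]

lemma omega_psd (ρ : Matrix (α × β) (α × β) ℂ) (hρ : IsDensity ρ) {n : ℕ} (Pr : Protocol α β n) :
    (stateAfterUA ρ Pr).PosSemidef ∧ (stateAfterUA ρ Pr).trace = 1 := by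
  obtain ⟨h1, h2⟩ := tpowAB_psd ρ hρ.1 hρ.2 n
  rw [omega_eq]
  refine ⟨h1.mul_mul_conjTranspose_same _, ?_⟩
  rw [Matrix.mul_assoc, trace_mul_comm, Matrix.mul_assoc, conjTranspose_kronecker,
    ← mul_kronecker_mul, isoV_iso, conjTranspose_one, Matrix.mul_one, one_kronecker_one,
    Matrix.mul_one, h2]

lemma omega_A (ρ : Matrix (α × β) (α × β) ℂ) {n : ℕ} (Pr : Protocol α β n)
    (i : (Fin Pr.dAp × Fin Pr.dY) × Fin Pr.dAg) :
    (isoV Pr * ptraceRight (tpowAB ρ n) * (isoV Pr)ᴴ) i i = ∑ c, stateAfterUA ρ Pr (i, c) (i, c) := by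
  simp only [omega_apply, mul_apply, ptraceRight, Finset.sum_mul, Finset.mul_sum, conjTranspose_apply]
  rw [Finset.sum_comm' (t' := univ) (s' := fun _ => univ) (by simp)]
  conv_rhs => rw [Finset.sum_comm]
  rw [Finset.sum_comm]
  refine Finset.sum_congr rfl fun x' _ => ?_
  rw [Finset.sum_comm]

lemma omega_B (ρ : Matrix (α × β) (α × β) ℂ) {n : ℕ} (Pr : Protocol α β n) :
    ptraceLeft (ptraceRight (Matrix.reindex
      (pullYB (Fin Pr.dAp) (Fin Pr.dY) (Fin Pr.dAg) (Fin n → β))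
      (pullYB (Fin Pr.dAp) (Fin Pr.dY) (Fin Pr.dAg) (Fin n → β)) (stateAfterUA ρ Pr)))
    = ptraceLeft (tpowAB ρ n) := by
  ext c c'
  have h1 : ptraceLeft (ptraceRight (Matrix.reindex
      (pullYB (Fin Pr.dAp) (Fin Pr.dY) (Fin Pr.dAg) (Fin n → β))
      (pullYB (Fin Pr.dAp) (Fin Pr.dY) (Fin Pr.dAg) (Fin n → β)) (stateAfterUA ρ Pr))) c c'
      = ∑ y, ∑ pg : Fin Pr.dAp × Fin Pr.dAg,
        stateAfterUA ρ Pr (((pg.1, y), pg.2), c) (((pg.1, y), pg.2), c') := rfl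
  have h2 : ∑ y, ∑ pg : Fin Pr.dAp × Fin Pr.dAg,
        stateAfterUA ρ Pr (((pg.1, y), pg.2), c) (((pg.1, y), pg.2), c')
      = ∑ i, stateAfterUA ρ Pr (i, c) (i, c') := by
    simp only [Fintype.sum_prod_type]
    rw [Finset.sum_comm]
  rw [h1, h2]
  simp only [omega_apply, ptraceLeft]
  rw [Finset.sum_comm]
  refine Finset.sum_congr rfl fun x' _ => ?_
  rw [Finset.sum_comm]
  have h3 : ∀ x, ∑ i, isoV Pr i x * tpowAB ρ n (x, c) (x', c') * star (isoV Pr i x')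
      = tpowAB ρ n (x, c) (x', c') * (1 : Matrix (Fin n → α) (Fin n → α) ℂ) x' x := by
    intro x
    rw [← isoV_iso Pr, mul_apply, Finset.mul_sum]
    refine Finset.sum_congr rfl fun i _ => ?_
    rw [conjTranspose_apply]; ring
  simp only [h3, one_apply]
  simp

lemma deph_apply (ρ : Matrix (α × β) (α × β) ℂ) {n : ℕ} (Pr : Protocol α β n)
    (p p' : Fin Pr.dAp) (y y' : Fin Pr.dY) (k k' : Fin Pr.dAg) (c c' : Fin n → β) :
    stateAfterDephasing ρ Pr (((p, y), k), c) (((p', y'), k'), c')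
      = if y = y' then stateAfterUA ρ Pr (((p, y), k), c) (((p', y'), k'), c') else 0 := rfl

lemma out_trace (ρ : Matrix (α × β) (α × β) ℂ) (hρ : IsDensity ρ) {n : ℕ} (Pr : Protocol α β n) :
    (outputReduced ρ Pr).trace = 1 := by
  have h1 : (outputReduced ρ Pr).trace = (stateAfterUB ρ Pr).trace := by
    rw [outputReduced, ptr_trace]
    exact Equiv.sum_comp (sortOut (Fin Pr.dBp) (Fin Pr.dBg) (Fin Pr.dAp) (Fin Pr.dAg)).symm
      (fun i => stateAfterUB ρ Pr i i)
  have h2 : (stateAfterUB ρ Pr).trace = (stateAfterDephasing ρ Pr).trace := by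
    rw [stateAfterUB, Matrix.mul_assoc, trace_mul_comm, Matrix.mul_assoc, conjTranspose_kronecker,
      ← mul_kronecker_mul, Pr.UB_unitary.1, conjTranspose_one, Matrix.mul_one, one_kronecker_one,
      Matrix.mul_one]
    exact Equiv.sum_comp (pullBY (Fin Pr.dAp) (Fin Pr.dY) (Fin Pr.dAg) (Fin n → β)).symm
      (fun i => stateAfterDephasing ρ Pr i i)
  rw [h1, h2, ← (omega_psd ρ hρ Pr).2]
  refine Finset.sum_congr rfl fun i _ => ?_
  obtain ⟨⟨⟨p, y⟩, k⟩, c⟩ := i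
  simp only [diag_apply, deph_apply, if_true]

lemma out_entry (ρ : Matrix (α × β) (α × β) ℂ) {n : ℕ} (Pr : Protocol α β n)
    (p : Fin Pr.dAp) (q : Fin Pr.dBp) :
    outputReduced ρ Pr (p, q) (p, q) = ∑ y, ∑ k, ((stateAfterUA ρ Pr).submatrix
      (Prod.mk ((p, y), k)) (Prod.mk ((p, y), k)) * effM Pr q y).trace := by
  have h1 : outputReduced ρ Pr (p, q) (p, q)
      = ∑ kb : Fin Pr.dAg × Fin Pr.dBg, stateAfterUB ρ Pr ((q, kb.2), (p, kb.1)) ((q, kb.2), (p, kb.1)) :=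
    rfl
  have h2 : ∀ k j, stateAfterUB ρ Pr ((q, j), (p, k)) ((q, j), (p, k))
      = ∑ y, ∑ c', ∑ c, Pr.UB (q, j) (c, y) * stateAfterUA ρ Pr (((p, y), k), c) (((p, y), k), c')
        * star (Pr.UB (q, j) (c', y)) := by
    intro k j
    rw [stateAfterUB, conjTranspose_kronecker, conjTranspose_one]
    have hre : ∀ (c c' : Fin n → β) (y y' : Fin Pr.dY) (u u' : Fin Pr.dAp × Fin Pr.dAg),
        (Matrix.reindex (pullBY (Fin Pr.dAp) (Fin Pr.dY) (Fin Pr.dAg) (Fin n → β))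
      (pullBY (Fin Pr.dAp) (Fin Pr.dY) (Fin Pr.dAg) (Fin n → β)) (stateAfterDephasing ρ Pr))
        ((c, y), u) ((c', y'), u')
        = if y = y' then stateAfterUA ρ Pr (((u.1, y), u.2), c) (((u'.1, y'), u'.2), c') else 0 :=
      fun _ _ _ _ _ _ => rfl
    generalize Matrix.reindex (pullBY (Fin Pr.dAp) (Fin Pr.dY) (Fin Pr.dAg) (Fin n → β))
      (pullBY (Fin Pr.dAp) (Fin Pr.dY) (Fin Pr.dAg) (Fin n → β)) (stateAfterDephasing ρ Pr) = R at hre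
    rw [mul_apply, Fintype.sum_prod_type]
    have h3 : ∀ c' y', ∑ u, ((Pr.UB ⊗ₖ (1 : Matrix (Fin Pr.dAp × Fin Pr.dAg) (Fin Pr.dAp × Fin Pr.dAg) ℂ)) * R)
          ((q, j), (p, k)) ((c', y'), u) *
          (Pr.UBᴴ ⊗ₖ (1 : Matrix (Fin Pr.dAp × Fin Pr.dAg) (Fin Pr.dAp × Fin Pr.dAg) ℂ)) ((c', y'), u) ((q, j), (p, k))
        = ∑ c, Pr.UB (q, j) (c, y') * stateAfterUA ρ Pr (((p, y'), k), c) (((p, y'), k), c')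
        * star (Pr.UB (q, j) (c', y')) := by
      intro c' y'
      rw [Finset.sum_eq_single (p, k)]
      · rw [mul_apply, Fintype.sum_prod_type, kroneckerMap_apply, one_apply_eq, mul_one,
          conjTranspose_apply, ← Finset.sum_mul, Fintype.sum_prod_type]
        congr 1
        refine Finset.sum_congr rfl fun c _ => ?_
        rw [Finset.sum_eq_single y']
        · rw [Finset.sum_eq_single (p, k)]
          · rw [kroneckerMap_apply, one_apply_eq, mul_one, hre, if_pos rfl]
          · intro u _ hu
            rw [kroneckerMap_apply, one_apply_ne (Ne.symm hu), mul_zero, zero_mul]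
          · simp
        · intro y _ hy
          refine Finset.sum_eq_zero fun u _ => ?_
          rw [hre, if_neg hy, mul_zero]
        · simp
      · intro u _ hu
        rw [kroneckerMap_apply, one_apply_ne hu, mul_zero, mul_zero]
      · simp
    rw [Fintype.sum_prod_type, Finset.sum_comm]
    exact Finset.sum_congr rfl fun y _ => Finset.sum_congr rfl fun c' _ => h3 c' y
  rw [h1, Fintype.sum_prod_type]
  simp only [h2]
  have h4 : ∀ y k, ((stateAfterUA ρ Pr).submatrix
      (Prod.mk ((p, y), k)) (Prod.mk ((p, y), k)) * effM Pr q y).trace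
      = ∑ j, ∑ c', ∑ c, Pr.UB (q, j) (c, y) * stateAfterUA ρ Pr (((p, y), k), c) (((p, y), k), c')
        * star (Pr.UB (q, j) (c', y)) := by
    intro y k
    simp only [trace, diag_apply, effM, mul_apply, conjTranspose_apply, of_apply, submatrix_apply,
      Finset.mul_sum]
    rw [Finset.sum_comm]
    conv_rhs => rw [Finset.sum_comm]
    refine Finset.sum_congr rfl fun c' _ => ?_
    rw [Finset.sum_comm]
    refine Finset.sum_congr rfl fun j _ => Finset.sum_congr rfl fun c _ => ?_
    ring
  simp only [h4]
  rw [Finset.sum_comm' (t' := univ) (s' := fun _ => univ) (by simp)]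
  conv_rhs => rw [Finset.sum_comm]
  rw [Finset.sum_comm]
  refine Finset.sum_congr rfl fun k _ => ?_
  rw [Finset.sum_comm]

lemma pureZero_trace (d : ℕ) (hd : 0 < d) : (pureZero d).trace = 1 := by
  rw [trace, Finset.sum_eq_single (⟨0, hd⟩ : Fin d)]
  · simp [pureZero]
  · intro i _ hi
    have : i.val ≠ 0 := fun h => hi (Fin.ext h)
    simp [pureZero, this]
  · simp

lemma err_ge (ρ : Matrix (α × β) (α × β) ℂ) (hρ : IsDensity ρ) {n : ℕ} (Pr : Protocol α β n) :
    2 * (1 - (outputReduced ρ Pr (⟨0, Pr.dAp_pos⟩, ⟨0, Pr.dBp_pos⟩)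
      (⟨0, Pr.dAp_pos⟩, ⟨0, Pr.dBp_pos⟩)).re) ≤ protocolError ρ Pr := by
  have h := traceNorm_ge (outputReduced ρ Pr - pureZero Pr.dAp ⊗ₖ pureZero Pr.dBp)
    (⟨0, Pr.dAp_pos⟩, ⟨0, Pr.dBp_pos⟩)
    (by rw [trace_sub, out_trace ρ hρ, trace_kronecker, pureZero_trace _ Pr.dAp_pos,
      pureZero_trace _ Pr.dBp_pos]; simp)
  refine le_trans (le_of_eq ?_) h
  simp only [Matrix.sub_apply, kroneckerMap_apply, Complex.sub_re]
  simp [pureZero]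
  ring

lemma converse_aux (ρ : Matrix (α × β) (α × β) ℂ) (hρ : IsDensity ρ)
    {n : ℕ} (hn : 0 < n) (Pr : Protocol α β n) (ε : ℝ) (hε : protocolError ρ Pr ≤ ε) :
    (n : ℝ) * entropy (ptraceRight ρ) + (n : ℝ) * entropy (ptraceLeft ρ)
        - preDephIYB ρ Pr
        - (n : ℝ) * (2 / (Real.exp 1 * n)
            + ε * Real.log ((Fintype.card α : ℝ) * (Fintype.card β : ℝ)))
      ≤ Real.log ((Pr.dAg : ℝ) * (Pr.dBg : ℝ)) := by
  have hne : Nonempty (α × β) := by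
    by_contra h
    rw [not_nonempty_iff] at h
    have := hρ.2
    simp [trace] at this
  haveI : Nonempty α := ⟨hne.some.1⟩
  haveI : Nonempty β := ⟨hne.some.2⟩
  haveI : Nonempty (Fin Pr.dAg) := ⟨⟨0, Pr.dAg_pos⟩⟩
  obtain ⟨hω, hω1⟩ := omega_psd ρ hρ Pr
  obtain ⟨a1, a2, a3⟩ := tpow_spec (ptraceRight ρ) (ptr_psd ρ hρ.1) (by rw [ptr_trace, hρ.2]) n
  obtain ⟨b1, b2, b3⟩ := tpow_spec (ptraceLeft ρ) (ptl_psd ρ hρ.1) (by rw [ptl_trace, hρ.2]) n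
  set τ := ptraceRight (Matrix.reindex
    (pullYB (Fin Pr.dAp) (Fin Pr.dY) (Fin Pr.dAg) (Fin n → β))
    (pullYB (Fin Pr.dAp) (Fin Pr.dY) (Fin Pr.dAg) (Fin n → β)) (stateAfterUA ρ Pr)) with hτ
  have hB : (0:ℝ) < Pr.dBg := by exact_mod_cast Pr.dBg_pos
  have hc := core (⟨0, Pr.dAp_pos⟩ : Fin Pr.dAp) (stateAfterUA ρ Pr) hω hω1
    (fun y => effM Pr ⟨0, Pr.dBp_pos⟩ y) (fun y => effM_psd Pr _ y) (fun y => effM_one_sub Pr _ y)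
    (Pr.dBg : ℝ) (effM_trace Pr _) hB (isoV Pr) (isoV_iso Pr) (tpow (ptraceRight ρ) n) a1 a2
    (by rw [← ptr_tpowAB]; exact omega_A ρ Pr) τ hτ
    ((outputReduced ρ Pr (⟨0, Pr.dAp_pos⟩, ⟨0, Pr.dBp_pos⟩)
      (⟨0, Pr.dAp_pos⟩, ⟨0, Pr.dBp_pos⟩)).re) _
    (by rw [out_entry]; simp only [Complex.re_sum]) rfl
  have herr := (err_ge ρ hρ Pr).trans hε
  generalize (outputReduced ρ Pr (⟨0, Pr.dAp_pos⟩, ⟨0, Pr.dBp_pos⟩)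
      (⟨0, Pr.dAp_pos⟩, ⟨0, Pr.dBp_pos⟩)).re = g at hc herr
  obtain ⟨c1, c2, c3, c4, c5, c6, c7⟩ := hc
  have hfin := final_real _ _ _ g ε (Fintype.card (Fin n → α)) (Fintype.card (Fin n → β))
    (Fintype.card (Fin Pr.dAg)) Pr.dBg Fintype.card_pos Fintype.card_pos Fintype.card_pos
    Pr.dBg_pos c1 c2 rfl herr c3 c4 c5 c6 c7
  have hI : preDephIYB ρ Pr = entropy (ptraceRight τ) + n * entropy (ptraceLeft ρ) - entropy τ := by
    have : preDephIYB ρ Pr = entropy (ptraceRight τ) + entropy (ptraceLeft τ) - entropy τ := rfl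
    rw [this, hτ, omega_B, ptl_tpowAB, b3]
  have hα : (Fintype.card α : ℝ) ≠ 0 := by exact_mod_cast Fintype.card_ne_zero
  have hβ : (Fintype.card β : ℝ) ≠ 0 := by exact_mod_cast Fintype.card_ne_zero
  have hnn : (n : ℝ) ≠ 0 := by exact_mod_cast hn.ne'
  have hA : (Pr.dAg : ℝ) ≠ 0 := by exact_mod_cast Pr.dAg_pos.ne'
  have hδ : (n : ℝ) * (2 / (Real.exp 1 * n)
      + ε * Real.log ((Fintype.card α : ℝ) * (Fintype.card β : ℝ)))
      = 2 / Real.exp 1 + ε * (n * Real.log (Fintype.card α) + n * Real.log (Fintype.card β)) := by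
    rw [Real.log_mul hα hβ]
    field_simp
  simp only [Fintype.card_pi, Finset.prod_const, Finset.card_univ, Fintype.card_fin, Nat.cast_pow,
    Real.log_pow, a3] at hfin
  rw [hI, hδ, Real.log_mul hA hB.ne']
  linarith


/-- **Converse garbage-dimension bound.** For any `(n,R,P,ε)` protocol, with
`δ = 2/(en) + ε log(d_A d_B)` and entropies evaluated on the pre-dephasing state
`U_A((ρ^{AB})^{⊗n} ⊗ |0⟩⟨0|^C)`,
`log(d_{A_g} d_{B_g}) ≥ n H(A)_ρ + n H(B)_ρ - I(Y;B^n) - nδ`. -/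
theorem converse_garbage_bound {α β : Type*} [Fintype α] [DecidableEq α] [Fintype β]
    [DecidableEq β] (ρ : Matrix (α × β) (α × β) ℂ) (hρ : IsDensity ρ)
    {n : ℕ} (hn : 0 < n) (Pr : Protocol α β n) (ε : ℝ) (hε : protocolError ρ Pr ≤ ε) :
    (n : ℝ) * entropy (ptraceRight ρ) + (n : ℝ) * entropy (ptraceLeft ρ)
        - preDephIYB ρ Pr
        - (n : ℝ) * (2 / (Real.exp 1 * n)
            + ε * Real.log ((Fintype.card α : ℝ) * (Fintype.card β : ℝ)))
      ≤ Real.log ((Pr.dAg : ℝ) * (Pr.dBg : ℝ)) := by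
  exact converse_aux ρ hρ hn Pr ε hε

end LPD
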